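/- arXiv:1606.05861 — 3 statements merged into one kernel-verified Lean document; each statement's English description precedes it below -/
import Mathlib

section
/- There exists a constant C > 0 depending only on n such that for all x₀, x' ∈ ℝⁿ, all r > 0, a > 0, b > 0, T > 0, every u₀ ∈ C₀^∞(ℝⁿ;ℂ) and every ε ∈ (0,1): ∫_{ℝⁿ} e^{−b|x−x'|} |u(x,T;u₀)|² dx ≤ exp( C [1 + (|x₀−x'| + r + b^{−1})/((aT) ∧ r)] ) · ( ε ∫_{ℝⁿ} e^{a|x|} |u₀(x)|² dx + ε · exp( ε^{−1 − C b^{−1}/((aT) ∧ r)} ) · ∫_{B_r(x₀)} |u(x,T;u₀)|² dx ). -/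
open MeasureTheory Filter Metric
open scoped Real RealInnerProductSpace ENNReal Topology

/-- The Fourier transform with the normalization
`f̂(ξ) = (2π)^{-n/2} ∫ f(x) e^{-i x·ξ} dx`. -/
noncomputable def fourierTransformPaper (n : ℕ) (f : EuclideanSpace ℝ (Fin n) → ℂ)
    (ξ : EuclideanSpace ℝ (Fin n)) : ℂ :=
  (((2 * Real.pi) ^ (-(n : ℝ) / 2) : ℝ) : ℂ) *
    ∫ x : EuclideanSpace ℝ (Fin n), Complex.exp (-Complex.I * (⟪x, ξ⟫ : ℝ)) * f x

/-- The solution `u(·,t;f) = e^{itΔ} f` of the free Schrödinger equation with (nice) initial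
datum `f`, obtained by Fourier inversion of `e^{-it|ξ|²} f̂(ξ)`. -/
noncomputable def schrodingerSol (n : ℕ) (f : EuclideanSpace ℝ (Fin n) → ℂ) (t : ℝ)
    (x : EuclideanSpace ℝ (Fin n)) : ℂ :=
  (((2 * Real.pi) ^ (-(n : ℝ) / 2) : ℝ) : ℂ) *
    ∫ ξ : EuclideanSpace ℝ (Fin n),
      Complex.exp (Complex.I * ((⟪x, ξ⟫ - t * ‖ξ‖ ^ 2 : ℝ) : ℂ)) * fourierTransformPaper n f ξ

/-- `f ∈ C₀^∞(ℝⁿ; ℂ)`. -/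
def IsTestFun (n : ℕ) (f : EuclideanSpace ℝ (Fin n) → ℂ) : Prop :=
  ContDiff ℝ (⊤ : ℕ∞) f ∧ HasCompactSupport f


lemma uc_segment_step (H : ℂ → ℂ) (hH : Differentiable ℂ H) (c : ℝ) (hc : 0 < c)
    (hb : ∀ s : ℂ, |s.im| ≤ 2 * c → ‖H s‖ ≤ 1) (k : ℕ) (σ : ℝ)
    (hs : ∀ t : ℝ, |t| ≤ c → ‖H t‖ ^ k ≤ σ) :
    ‖H ((c * Real.cosh (1 / 2) : ℝ) : ℂ)‖ ^ (2 * k) ≤ σ := by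
  have hσ : 0 ≤ σ := le_trans (by positivity) (hs 0 (by simpa using hc.le))
  have hsinh : Real.sinh 1 ≤ 2 := by
    rw [Real.sinh_eq]
    have := Real.exp_one_lt_d9
    have := Real.exp_pos (-1)
    linarith
  have hbd : ∀ z : ℂ, z.re ∈ Set.Icc (0:ℝ) 1 → ‖H (c * Complex.cosh z) ^ k‖ ≤ 1 := by
    intro z hz
    rw [norm_pow]
    apply pow_le_one₀ (norm_nonneg _)
    apply hb
    have him : (Complex.cosh z).im = Real.sinh z.re * Real.sin z.im := by
      conv_lhs => rw [← Complex.re_add_im z, Complex.cosh_add, Complex.cosh_mul_I, Complex.sinh_mul_I]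
      rw [← Complex.ofReal_cosh, ← Complex.ofReal_sinh, ← Complex.ofReal_cos, ← Complex.ofReal_sin]
      simp only [Complex.add_im, Complex.mul_im, Complex.mul_re, Complex.ofReal_re,
        Complex.ofReal_im, Complex.I_re, Complex.I_im]
      ring
    rw [Complex.im_ofReal_mul, him, abs_mul, abs_mul, abs_of_pos hc]
    have h1 := Real.abs_sin_le_one z.im
    have h2 : |Real.sinh z.re| ≤ 2 := by
      rw [abs_of_nonneg (Real.sinh_nonneg_iff.mpr hz.1)]
      exact (Real.sinh_le_sinh.mpr hz.2).trans hsinh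
    have h3 : |Real.sinh z.re| * |Real.sin z.im| ≤ 2 * 1 := by gcongr
    nlinarith
  have key := Complex.HadamardThreeLines.norm_le_interp_of_mem_verticalClosedStrip₀₁'
    (fun z => H (c * Complex.cosh z) ^ k) (z := ((1/2 : ℝ) : ℂ)) (a := σ) (b := 1)
    (by simp only [Complex.HadamardThreeLines.verticalClosedStrip, Set.mem_preimage, Complex.ofReal_re, Set.mem_Icc]; norm_num)
    (Differentiable.diffContOnCl (by
      refine Differentiable.pow ?_ k
      exact hH.comp (Complex.differentiable_cosh.const_mul _)))
    ⟨1, by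
      rintro _ ⟨z, hz, rfl⟩
      exact hbd z hz⟩
    (by
      intro z hz
      have hz0 : z.re = 0 := hz
      have : Complex.cosh z = (Real.cos z.im : ℂ) := by
        conv_lhs => rw [← Complex.re_add_im z, hz0]
        simp [Complex.cosh_mul_I]
      rw [norm_pow, this, ← Complex.ofReal_mul]
      apply hs
      rw [abs_mul, abs_of_pos hc]
      have := Real.abs_cos_le_one z.im
      nlinarith)
    (by
      intro z hz
      have hz0 : z.re = 1 := hz
      exact hbd z (by rw [hz0]; simp))
  simp only [Complex.ofReal_re, Real.one_rpow, mul_one, norm_pow] at key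
  rw [mul_comm 2 k, pow_mul]
  have h2 : (σ ^ (1 - 1 / 2 : ℝ)) ^ 2 = σ := by
    rw [← Real.rpow_natCast, ← Real.rpow_mul hσ]; norm_num
  rw [← h2]
  have e : ((c * Real.cosh (1 / 2) : ℝ) : ℂ) = c * Complex.cosh ((1/2 : ℝ) : ℂ) := by
    rw [Complex.ofReal_mul, Complex.ofReal_cosh]
  rw [e]
  gcongr

lemma uc_propagation {E : Type*} [NormedAddCommGroup E] [NormedSpace ℝ E] (g : E → ℂ) (c : ℝ)
    (hc : 0 < c)
    (hg : ∀ y w : E, ‖w‖ = 1 → ∃ H : ℂ → ℂ, Differentiable ℂ H ∧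
      (∀ t : ℝ, H t = g (y + t • w)) ∧ ∀ s : ℂ, |s.im| ≤ 2 * c → ‖H s‖ ≤ 1)
    (hg1 : ∀ x, ‖g x‖ ≤ 1) (x₀ : E) (k : ℕ) (σ : ℝ) (h0 : ∀ x, ‖x - x₀‖ ≤ 2 * c → ‖g x‖ ^ k ≤ σ) (N : ℕ) :
    ∀ x, ‖x - x₀‖ ≤ 2 * c + N * (c / 8) → ‖g x‖ ^ (k * 2 ^ N) ≤ σ := by
  induction N with
  | zero => simpa using h0
  | succ N ih =>
    intro x hx
    have hpow : k * 2 ^ (N + 1) = 2 * (k * 2 ^ N) := by ring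
    rw [hpow]
    by_cases hxs : ‖x - x₀‖ ≤ 2 * c + N * (c / 8)
    · have h1 := ih x hxs
      rw [mul_comm 2, pow_mul]
      refine le_trans ?_ h1
      exact pow_le_of_le_one (by positivity) (pow_le_one₀ (norm_nonneg _) (hg1 x)) (by norm_num)
    push Not at hxs
    set d := ‖x - x₀‖ with hd
    set w := d⁻¹ • (x - x₀) with hw
    have hN : (0:ℝ) ≤ N * (c / 8) := by positivity
    have hdpos : 0 < d := by linarith
    have hwn : ‖w‖ = 1 := by
      rw [hw, norm_smul, norm_inv, Real.norm_of_nonneg hdpos.le, ← hd, inv_mul_cancel₀ hdpos.ne']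
    have hdw : d • w = x - x₀ := by
      rw [hw, smul_smul, mul_inv_cancel₀ hdpos.ne', one_smul]
    set q := Real.cosh (1/2) with hq
    have hq1 : 1 + 1 / 8 ≤ q := by
      rw [hq, Real.cosh_eq, Real.exp_neg]
      have h1 := Real.exp_one_gt_d9
      have h2 : Real.exp (1/2) ^ 2 = Real.exp 1 := by
        rw [← Real.exp_nat_mul]; norm_num
      have h3 := Real.exp_pos (1/2)
      have h4 : 1.64 ≤ Real.exp (1/2) := by nlinarith
      have h5 : Real.exp (1/2) * (Real.exp (1/2))⁻¹ = 1 := mul_inv_cancel₀ h3.ne'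
      have h6 : (1 + 1/8) * 2 * Real.exp (1/2) ≤ Real.exp (1/2) ^ 2 + 1 := by nlinarith
      have h7 : (1 + 1/8) * 2 ≤ (Real.exp (1/2) ^ 2 + 1) / Real.exp (1/2) := by
        rw [le_div_iff₀ h3]; exact h6
      have h8 : (Real.exp (1/2) ^ 2 + 1) / Real.exp (1/2) = Real.exp (1/2) + (Real.exp (1/2))⁻¹ := by
        field_simp
      linarith
    have hq2 : q ≤ 3 := by
      rw [hq, Real.cosh_eq]
      have h1 := Real.exp_one_lt_d9
      have h2 : Real.exp (1/2) ≤ Real.exp 1 := Real.exp_le_exp.mpr (by norm_num)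
      have h3 : Real.exp (-(1/2)) ≤ 1 := Real.exp_le_one_iff.mpr (by norm_num)
      linarith
    obtain ⟨H, hH, hHg, hHb⟩ := hg (x₀ + (d - c * q) • w) w hwn
    have := uc_segment_step H hH c hc hHb (k * 2 ^ N) σ (by
      intro t ht
      rw [hHg]
      apply ih
      have : x₀ + (d - c * q) • w + t • w - x₀ = (d - c * q + t) • w := by
        rw [add_smul]; abel
      rw [this, norm_smul, hwn, mul_one, Real.norm_eq_abs]
      rw [abs_le] at ht ⊢
      push_cast at hx
      constructor <;> nlinarith)
    rw [hHg] at this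
    have e : x₀ + (d - c * q) • w + (c * q) • w = x := by
      rw [add_assoc, ← add_smul, sub_add_cancel, hdw]; abel
    rwa [e] at this


lemma uc_fourier_integrable (n : ℕ) (u₀ : EuclideanSpace ℝ (Fin n) → ℂ) (hu : IsTestFun n u₀) :
    Integrable (fun ξ => fourierTransformPaper n u₀ ξ) := by
  let f : SchwartzMap (EuclideanSpace ℝ (Fin n)) ℂ := hu.2.toSchwartzMap hu.1
  have h1 : Integrable (fun ξ => (FourierTransform.fourier f) ((2 * π)⁻¹ • ξ)) :=
    (FourierTransform.fourier f).integrable.comp_smul (by positivity)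
  refine (h1.const_mul (((2 * Real.pi) ^ (-(n : ℝ) / 2) : ℝ) : ℂ)).congr (Eventually.of_forall ?_)
  intro ξ
  simp only [fourierTransformPaper]
  congr 1
  rw [SchwartzMap.fourier_coe, Real.fourier_eq']
  apply integral_congr_ae
  refine Eventually.of_forall fun v => ?_
  simp only [smul_eq_mul]
  congr 2
  rw [real_inner_smul_right]
  push_cast
  field_simp

lemma uc_gauss_norm (b : ℂ) (hb : 0 ≤ b.re) (s : ℝ) (hs : 0 ≤ s) : ‖Complex.exp (-b * s)‖ ≤ 1 := by
  rw [Complex.norm_exp, Real.exp_le_one_iff]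
  simp
  positivity

lemma uc_rep_delta (n : ℕ) (u₀ : EuclideanSpace ℝ (Fin n) → ℂ) (hu : IsTestFun n u₀)
    (b : ℂ) (hb : 0 < b.re) (x : EuclideanSpace ℝ (Fin n)) :
    ∫ ξ : EuclideanSpace ℝ (Fin n), Complex.exp (-b * ‖ξ‖ ^ 2 + Complex.I * ⟪x, ξ⟫) *
      fourierTransformPaper n u₀ ξ = (((2 * Real.pi) ^ (-(n : ℝ) / 2) : ℝ) : ℂ) *
       ((π / b) ^ (n / 2 : ℂ) *
        ∫ v : EuclideanSpace ℝ (Fin n), Complex.exp (-(‖x - v‖ ^ 2) / (4 * b)) * u₀ v) := by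
  have hcont : Continuous u₀ := hu.1.continuous
  have hint : Integrable u₀ := hcont.integrable_of_hasCompactSupport hu.2
  have hG := GaussianFourier.integrable_cexp_neg_mul_sq_norm_add hb Complex.I x
  simp only [fourierTransformPaper]
  have h1 : ∀ ξ : EuclideanSpace ℝ (Fin n),
      Complex.exp (-b * ‖ξ‖ ^ 2 + Complex.I * ⟪x, ξ⟫) *
      ((((2 * Real.pi) ^ (-(n : ℝ) / 2) : ℝ) : ℂ) *
        ∫ v : EuclideanSpace ℝ (Fin n), Complex.exp (-Complex.I * (⟪v, ξ⟫ : ℝ)) * u₀ v) =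
      (((2 * Real.pi) ^ (-(n : ℝ) / 2) : ℝ) : ℂ) * ∫ v : EuclideanSpace ℝ (Fin n),
        Complex.exp (-b * ‖ξ‖ ^ 2 + Complex.I * ⟪x, ξ⟫) *
          (Complex.exp (-Complex.I * (⟪v, ξ⟫ : ℝ)) * u₀ v) := by
    intro ξ
    rw [integral_const_mul]; ring
  simp_rw [h1]
  rw [integral_const_mul]
  congr 1
  rw [integral_integral_swap]
  · rw [← integral_const_mul]
    congr 1
    ext v
    have h2 := GaussianFourier.integral_cexp_neg_mul_sq_norm_add hb Complex.I (x - v)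
    have h3 : ∀ ξ : EuclideanSpace ℝ (Fin n), Complex.exp (-b * ‖ξ‖ ^ 2 + Complex.I * ⟪x, ξ⟫) *
          (Complex.exp (-Complex.I * (⟪v, ξ⟫ : ℝ)) * u₀ v) =
          Complex.exp (-b * ‖ξ‖ ^ 2 + Complex.I * (⟪x - v, ξ⟫ : ℝ)) * u₀ v := by
      intro ξ
      rw [← mul_assoc, ← Complex.exp_add, inner_sub_left]
      congr 2
      push_cast
      ring
    simp_rw [h3]
    rw [integral_mul_const, h2]
    simp only [finrank_euclideanSpace, Fintype.card_fin, Complex.I_sq]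
    ring_nf
  · refine (hG.mul_prod hint).mono ?_ ?_
    · apply Continuous.aestronglyMeasurable
      unfold Function.uncurry
      fun_prop
    · refine Eventually.of_forall fun p => ?_
      simp only [Function.uncurry, norm_mul]
      rw [show -Complex.I * (⟪p.2, p.1⟫ : ℝ) = ((-⟪p.2, p.1⟫ : ℝ) : ℂ) * Complex.I by push_cast; ring,
        Complex.norm_exp_ofReal_mul_I, one_mul]

lemma uc_rep (n : ℕ) (u₀ : EuclideanSpace ℝ (Fin n) → ℂ) (hu : IsTestFun n u₀)
    (T : ℝ) (hT : 0 < T) (x : EuclideanSpace ℝ (Fin n)) :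
    ‖schrodingerSol n u₀ T x‖ = (4 * π * T) ^ (-(n:ℝ) / 2) *
      ‖∫ v : EuclideanSpace ℝ (Fin n), Complex.exp (-Complex.I * ((⟪x, v⟫ / (2 * T) : ℝ) : ℂ)) *
        (Complex.exp (Complex.I * ((‖v‖ ^ 2 / (4 * T) : ℝ) : ℂ)) * u₀ v)‖ := by
  have hcont : Continuous u₀ := hu.1.continuous
  have hint : Integrable u₀ := hcont.integrable_of_hasCompactSupport hu.2
  have hFi := uc_fourier_integrable n u₀ hu
  let B : ℝ → ℂ := fun δ => δ + T * Complex.I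
  have hBc : Continuous B := by fun_prop
  have hBre : ∀ δ, (B δ).re = δ := by intro δ; simp [B]
  have hB0 : ∀ δ, B δ ≠ 0 := by
    intro δ h
    have := congrArg Complex.im h
    simp [B] at this
    exact hT.ne' this
  have lim1 : Tendsto (fun δ : ℝ => ∫ ξ : EuclideanSpace ℝ (Fin n),
      Complex.exp (-B δ * ‖ξ‖ ^ 2 + Complex.I * ⟪x, ξ⟫) * fourierTransformPaper n u₀ ξ)
      (𝓝[>] 0) (𝓝 (∫ ξ : EuclideanSpace ℝ (Fin n),
      Complex.exp (-B 0 * ‖ξ‖ ^ 2 + Complex.I * ⟪x, ξ⟫) * fourierTransformPaper n u₀ ξ)) := by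
    apply tendsto_integral_filter_of_dominated_convergence (fun ξ => ‖fourierTransformPaper n u₀ ξ‖)
    · refine Eventually.of_forall fun δ => ?_
      exact AEStronglyMeasurable.mul (Continuous.aestronglyMeasurable (by fun_prop))
        hFi.aestronglyMeasurable
    · filter_upwards [self_mem_nhdsWithin] with δ hδ
      refine Eventually.of_forall fun ξ => ?_
      rw [Complex.exp_add, norm_mul, norm_mul, mul_comm Complex.I, Complex.norm_exp_ofReal_mul_I,
        mul_one]
      have := uc_gauss_norm (B δ) (by rw [hBre]; exact (le_of_lt hδ)) (‖ξ‖ ^ 2) (by positivity)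
      push_cast at this
      exact mul_le_of_le_one_left (norm_nonneg _) this
    · exact hFi.norm
    · refine Eventually.of_forall fun ξ => ?_
      have : Continuous (fun δ : ℝ => Complex.exp (-B δ * ‖ξ‖ ^ 2 + Complex.I * ⟪x, ξ⟫) *
        fourierTransformPaper n u₀ ξ) := by fun_prop
      exact (this.tendsto 0).mono_left nhdsWithin_le_nhds
  have lim2 : Tendsto (fun δ : ℝ => ∫ v : EuclideanSpace ℝ (Fin n),
      Complex.exp (-(‖x - v‖ ^ 2) / (4 * B δ)) * u₀ v)
      (𝓝[>] 0) (𝓝 (∫ v : EuclideanSpace ℝ (Fin n),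
      Complex.exp (-(‖x - v‖ ^ 2) / (4 * B 0)) * u₀ v)) := by
    apply tendsto_integral_filter_of_dominated_convergence (fun v => ‖u₀ v‖)
    · refine Eventually.of_forall fun δ => ?_
      exact Continuous.aestronglyMeasurable (by fun_prop)
    · filter_upwards [self_mem_nhdsWithin] with δ hδ
      refine Eventually.of_forall fun v => ?_
      rw [norm_mul]
      have := uc_gauss_norm ((B δ)⁻¹) (by
        rw [Complex.inv_re, hBre]; exact div_nonneg (le_of_lt hδ) (Complex.normSq_nonneg _))
        (‖x - v‖ ^ 2 / 4) (by positivity)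
      have e : (-(‖x - v‖ ^ 2) / (4 * B δ) : ℂ) = -(B δ)⁻¹ * ((‖x - v‖ ^ 2 / 4 : ℝ) : ℂ) := by
        push_cast
        field_simp [hB0 δ]
      rw [e]
      exact mul_le_of_le_one_left (norm_nonneg _) this
    · exact hint.norm
    · refine Eventually.of_forall fun v => ?_
      have : Continuous (fun δ : ℝ => Complex.exp (-(‖x - v‖ ^ 2) / (4 * B δ)) * u₀ v) := by
        have : Continuous (fun δ : ℝ => (-(‖x - v‖ ^ 2) / (4 * B δ) : ℂ)) :=
          continuous_const.div (by fun_prop) (fun δ => mul_ne_zero (by norm_num) (hB0 δ))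
        fun_prop
      exact (this.tendsto 0).mono_left nhdsWithin_le_nhds
  have hpow : ∀ δ, ‖((π : ℂ) / B δ) ^ (n / 2 : ℂ)‖ = (π / ‖B δ‖) ^ (n / 2 : ℝ) := by
    intro δ
    rw [show (n / 2 : ℂ) = ((n / 2 : ℝ) : ℂ) by push_cast; rfl, Complex.norm_cpow_real, norm_div,
      Complex.norm_of_nonneg Real.pi_pos.le]
  have lim3 : Tendsto (fun δ : ℝ => (π / ‖B δ‖) ^ (n / 2 : ℝ)) (𝓝[>] 0)
      (𝓝 ((π / ‖B 0‖) ^ (n / 2 : ℝ))) := by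
    have : Continuous (fun δ : ℝ => (π / ‖B δ‖) ^ (n / 2 : ℝ)) := by
      refine Continuous.rpow_const ?_ ?_
      · exact continuous_const.div (by fun_prop) (fun δ => norm_ne_zero_iff.mpr (hB0 δ))
      · intro δ; right; positivity
    exact (this.tendsto 0).mono_left nhdsWithin_le_nhds
  set c0 : ℝ := (2 * Real.pi) ^ (-(n : ℝ) / 2) with hc0
  have hc0pos : 0 < c0 := by positivity
  have hnorm : ‖∫ ξ : EuclideanSpace ℝ (Fin n),
      Complex.exp (-B 0 * ‖ξ‖ ^ 2 + Complex.I * ⟪x, ξ⟫) * fourierTransformPaper n u₀ ξ‖ =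
      c0 * ((π / ‖B 0‖) ^ (n / 2 : ℝ) * ‖∫ v : EuclideanSpace ℝ (Fin n),
      Complex.exp (-(‖x - v‖ ^ 2) / (4 * B 0)) * u₀ v‖) := by
    refine tendsto_nhds_unique lim1.norm (((lim3.mul lim2.norm).const_mul c0).congr' ?_)
    filter_upwards [self_mem_nhdsWithin] with δ hδ
    rw [uc_rep_delta n u₀ hu (B δ) (by rw [hBre]; exact hδ) x, norm_mul, norm_mul, hpow,
      Complex.norm_of_nonneg hc0pos.le]
  have hBn : ‖B 0‖ = T := by simp [B, abs_of_pos hT]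
  have hS : schrodingerSol n u₀ T x = c0 * ∫ ξ : EuclideanSpace ℝ (Fin n),
      Complex.exp (-B 0 * ‖ξ‖ ^ 2 + Complex.I * ⟪x, ξ⟫) * fourierTransformPaper n u₀ ξ := by
    rw [schrodingerSol]
    congr 2
    ext ξ
    congr 2
    simp only [B]
    push_cast
    ring
  have hP : ‖∫ v : EuclideanSpace ℝ (Fin n), Complex.exp (-(‖x - v‖ ^ 2) / (4 * B 0)) * u₀ v‖ =
      ‖∫ v : EuclideanSpace ℝ (Fin n), Complex.exp (-Complex.I * ((⟪x, v⟫ / (2 * T) : ℝ) : ℂ)) *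
        (Complex.exp (Complex.I * ((‖v‖ ^ 2 / (4 * T) : ℝ) : ℂ)) * u₀ v)‖ := by
    have e : ∀ v : EuclideanSpace ℝ (Fin n), Complex.exp (-(‖x - v‖ ^ 2) / (4 * B 0)) * u₀ v =
        Complex.exp (((‖x‖ ^ 2 / (4 * T) : ℝ) : ℂ) * Complex.I) *
        (Complex.exp (-Complex.I * ((⟪x, v⟫ / (2 * T) : ℝ) : ℂ)) *
        (Complex.exp (Complex.I * ((‖v‖ ^ 2 / (4 * T) : ℝ) : ℂ)) * u₀ v)) := by
      intro v
      rw [← mul_assoc, ← mul_assoc, ← Complex.exp_add, ← Complex.exp_add]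
      congr 2
      have h := @norm_sub_sq_real _ _ _ x v
      rw [← Complex.ofReal_pow, h]
      have hTc : (T : ℂ) ≠ 0 := by exact_mod_cast hT.ne'
      simp only [B]
      push_cast
      rw [zero_add]
      field_simp
      rw [Complex.I_sq]
      ring
    simp_rw [e]
    rw [integral_const_mul, norm_mul, Complex.norm_exp_ofReal_mul_I, one_mul]
  rw [hS, norm_mul, hnorm, hP, hBn, Complex.norm_of_nonneg hc0pos.le, ← mul_assoc, ← mul_assoc]
  congr 1
  rw [hc0, ← Real.mul_rpow (by positivity) (by positivity), neg_div, Real.rpow_neg (by positivity),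
    Real.rpow_neg (by positivity), ← Real.inv_rpow (by positivity), ← Real.inv_rpow (by positivity),
    ← Real.mul_rpow (by positivity) (by positivity)]
  congr 1
  field_simp
  norm_num


/-- The oscillatory integral which represents the solution up to a unimodular factor. -/
noncomputable def ucG (n : ℕ) (T : ℝ) (F : EuclideanSpace ℝ (Fin n) → ℂ)
    (x : EuclideanSpace ℝ (Fin n)) : ℂ :=
  (((4 * π * T) ^ (-(n:ℝ) / 2) : ℝ) : ℂ) *
    ∫ v : EuclideanSpace ℝ (Fin n), Complex.exp (-Complex.I * ((⟪x, v⟫ / (2 * T) : ℝ) : ℂ)) * F v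

lemma uc_modulate (n : ℕ) (u₀ : EuclideanSpace ℝ (Fin n) → ℂ) (hu : IsTestFun n u₀) (T : ℝ) :
    IsTestFun n (fun v => Complex.exp (Complex.I * ((‖v‖ ^ 2 / (4 * T) : ℝ) : ℂ)) * u₀ v) := by
  refine ⟨?_, hu.2.mul_left⟩
  refine ContDiff.mul ?_ hu.1
  refine ContDiff.cexp (contDiff_const.mul ?_)
  exact Complex.ofRealCLM.contDiff.comp ((contDiff_norm_sq ℝ).div_const _)

lemma uc_rep' (n : ℕ) (u₀ : EuclideanSpace ℝ (Fin n) → ℂ) (hu : IsTestFun n u₀)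
    (T : ℝ) (hT : 0 < T) (x : EuclideanSpace ℝ (Fin n)) :
    ‖schrodingerSol n u₀ T x‖ = ‖ucG n T
      (fun v => Complex.exp (Complex.I * ((‖v‖ ^ 2 / (4 * T) : ℝ) : ℂ)) * u₀ v) x‖ := by
  rw [uc_rep n u₀ hu T hT x, ucG, norm_mul, Complex.norm_of_nonneg (by positivity)]

lemma uc_const_sq (n : ℕ) (T : ℝ) (hT : 0 < T) :
    ((4 * π * T) ^ (-(n:ℝ) / 2) : ℝ) ^ 2 = ((4 * π * T) ^ n)⁻¹ := by
  rw [← Real.rpow_natCast, ← Real.rpow_mul (by positivity), ← Real.rpow_natCast,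
    ← Real.rpow_neg (by positivity)]
  congr 1
  push_cast
  ring

lemma uc_plancherel (n : ℕ) (F : EuclideanSpace ℝ (Fin n) → ℂ) (hF : IsTestFun n F)
    (T : ℝ) (hT : 0 < T) :
    Integrable (fun x => ‖ucG n T F x‖ ^ 2) ∧ ∫ x, ‖ucG n T F x‖ ^ 2 = ∫ x, ‖F x‖ ^ 2 := by
  let f : SchwartzMap (EuclideanSpace ℝ (Fin n)) ℂ := hF.2.toSchwartzMap hF.1
  have hR : (4 * π * T)⁻¹ ≠ 0 := by positivity
  have e : ∀ x, ‖ucG n T F x‖ ^ 2 = ((4 * π * T) ^ n)⁻¹ *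
      ‖(FourierTransform.fourier f) ((4 * π * T)⁻¹ • x)‖ ^ 2 := by
    intro x
    rw [ucG, norm_mul, mul_pow, Complex.norm_of_nonneg (by positivity), uc_const_sq n T hT]
    congr 3
    rw [SchwartzMap.fourier_coe, Real.fourier_eq']
    apply integral_congr_ae
    refine Eventually.of_forall fun v => ?_
    simp only [smul_eq_mul]
    congr 2
    rw [real_inner_smul_right, real_inner_comm]
    push_cast
    field_simp
    norm_num
  have hI : Integrable (fun ξ => ‖(FourierTransform.fourier f) ξ‖ ^ 2) := by
    have := (FourierTransform.fourier f).memLp 2 (μ := volume)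
    exact this.integrable_norm_pow (by norm_num)
  simp_rw [e]
  constructor
  · exact (hI.comp_smul hR).const_mul _
  · rw [integral_const_mul,
      Measure.integral_comp_smul volume (fun ξ => ‖(FourierTransform.fourier f) ξ‖ ^ 2),
      SchwartzMap.integral_norm_sq_fourier, finrank_euclideanSpace, Fintype.card_fin, smul_eq_mul,
      ← mul_assoc]
    have : ((4 * π * T) ^ n)⁻¹ * |(((4 * π * T)⁻¹) ^ n)⁻¹| = 1 := by
      rw [abs_of_pos (by positivity), inv_pow, inv_inv]
      exact inv_mul_cancel₀ (by positivity)
    rw [this, one_mul]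
    rfl

lemma uc_int (n : ℕ) (F : EuclideanSpace ℝ (Fin n) → ℂ) (hF : IsTestFun n F)
    (φ : EuclideanSpace ℝ (Fin n) → ℝ) (hφ : Continuous φ) :
    Integrable (fun v => φ v * ‖F v‖) := by
  have := hF.1.continuous
  exact Continuous.integrable_of_hasCompactSupport (by fun_prop) hF.2.norm.mul_left

lemma uc_int' (n : ℕ) (F : EuclideanSpace ℝ (Fin n) → ℂ) (hF : IsTestFun n F)
    (φ : EuclideanSpace ℝ (Fin n) → ℂ) (hφ : Continuous φ) :
    Integrable (fun v => φ v * F v) := by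
  have := hF.1.continuous
  exact Continuous.integrable_of_hasCompactSupport (by fun_prop) hF.2.mul_left

lemma uc_cexp_norm (n : ℕ) (T : ℝ) (hT : 0 < T) (y w v : EuclideanSpace ℝ (Fin n))
    (hw : ‖w‖ = 1) (s : ℂ) (m : ℝ) (hs : |s.im| ≤ m) :
    ‖Complex.exp (-Complex.I * ((⟪y, v⟫ / (2 * T) : ℝ) + s * (⟪w, v⟫ / (2 * T) : ℝ)))‖ ≤
      Real.exp (m * ‖v‖ / (2 * T)) := by
  rw [Complex.norm_exp, Real.exp_le_exp]
  have : (-Complex.I * ((⟪y, v⟫ / (2 * T) : ℝ) + s * (⟪w, v⟫ / (2 * T) : ℝ))).re =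
      s.im * ⟪w, v⟫ / (2 * T) := by
    simp only [Complex.mul_re, Complex.neg_re, Complex.neg_im, Complex.I_re, Complex.I_im,
      Complex.add_im, Complex.add_re, Complex.mul_im, Complex.ofReal_re, Complex.ofReal_im]
    ring
  rw [this]
  have h1 : |⟪w, v⟫| ≤ ‖v‖ := by simpa [hw] using abs_real_inner_le_norm w v
  refine div_le_div_of_nonneg_right ?_ (by positivity)
  calc s.im * ⟪w, v⟫ ≤ |s.im * ⟪w, v⟫| := le_abs_self _
    _ = |s.im| * |⟪w, v⟫| := abs_mul _ _
    _ ≤ m * ‖v‖ := by gcongr; exact (abs_nonneg _).trans hs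

lemma uc_ext (n : ℕ) (F : EuclideanSpace ℝ (Fin n) → ℂ) (hF : IsTestFun n F)
    (T : ℝ) (hT : 0 < T) (a : ℝ) (y w : EuclideanSpace ℝ (Fin n)) (hw : ‖w‖ = 1) :
    ∃ H : ℂ → ℂ, Differentiable ℂ H ∧
      (∀ t : ℝ, H t = ucG n T F (y + t • w)) ∧ ∀ s : ℂ, |s.im| ≤ a * T / 2 →
        ‖H s‖ ≤ (4 * π * T) ^ (-(n:ℝ) / 2) * ∫ v, Real.exp (a / 4 * ‖v‖) * ‖F v‖ := by
  have hFc := hF.1.continuous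
  refine ⟨fun s => (((4 * π * T) ^ (-(n:ℝ) / 2) : ℝ) : ℂ) * ∫ v : EuclideanSpace ℝ (Fin n),
    Complex.exp (-Complex.I * ((⟪y, v⟫ / (2 * T) : ℝ) + s * (⟪w, v⟫ / (2 * T) : ℝ))) * F v,
    ?_, ?_, ?_⟩
  · refine Differentiable.const_mul ?_ _
    intro s₀
    have := hasDerivAt_integral_of_dominated_loc_of_deriv_le (μ := volume) (𝕜 := ℂ)
      (F := fun s (v : EuclideanSpace ℝ (Fin n)) => Complex.exp (-Complex.I * ((⟪y, v⟫ / (2 * T) : ℝ) + s * (⟪w, v⟫ / (2 * T) : ℝ))) * F v)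
      (F' := fun s v => Complex.exp (-Complex.I * ((⟪y, v⟫ / (2 * T) : ℝ) + s * (⟪w, v⟫ / (2 * T) : ℝ))) * (-Complex.I * (⟪w, v⟫ / (2 * T) : ℝ)) * F v)
      (x₀ := s₀) (s := Metric.ball s₀ 1)
      (bound := fun v => Real.exp ((‖s₀‖ + 1) * ‖v‖ / (2 * T)) * (‖v‖ / (2 * T)) * ‖F v‖)
      (Metric.ball_mem_nhds _ one_pos)
      (Eventually.of_forall fun s => Continuous.aestronglyMeasurable (by fun_prop))
      (uc_int' n F hF _ (by fun_prop))
      (Continuous.aestronglyMeasurable (by fun_prop))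
      (Eventually.of_forall fun v s hs => by
        rw [norm_mul, norm_mul]
        have h1 : |⟪w, v⟫| ≤ ‖v‖ := by simpa [hw] using abs_real_inner_le_norm w v
        have h2 := uc_cexp_norm n T hT y w v hw s (‖s₀‖ + 1) (by
          refine (Complex.abs_im_le_norm s).trans ?_
          have h3 : ‖s - s₀‖ < 1 := by simpa [dist_eq_norm] using hs
          have h4 := norm_sub_norm_le s s₀
          linarith)
        have h3 : ‖-Complex.I * ((⟪w, v⟫ / (2 * T) : ℝ) : ℂ)‖ ≤ ‖v‖ / (2 * T) := by
          rw [norm_mul, norm_neg, Complex.norm_I, one_mul, Complex.norm_real, Real.norm_eq_abs,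
            abs_div, abs_of_pos (show 0 < 2 * T by positivity)]
          gcongr
        gcongr)
      (uc_int n F hF _ (by fun_prop))
      (Eventually.of_forall fun v s hs => by
        have h1 : HasDerivAt (fun s : ℂ => -Complex.I * ((⟪y, v⟫ / (2 * T) : ℝ) + s * (⟪w, v⟫ / (2 * T) : ℝ)))
          (-Complex.I * (1 * (⟪w, v⟫ / (2 * T) : ℝ))) s :=
          (((hasDerivAt_id s).mul_const _).const_add _).const_mul _
        rw [one_mul] at h1
        exact (h1.cexp).mul_const _)
    exact this.2.differentiableAt
  · intro t
    simp only [ucG]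
    congr 2
    ext v
    congr 3
    rw [inner_add_left, real_inner_smul_left]
    push_cast
    ring
  · intro s hs
    rw [norm_mul, Complex.norm_of_nonneg (by positivity)]
    gcongr
    refine (norm_integral_le_integral_norm _).trans ?_
    refine integral_mono (uc_int' n F hF _ (by fun_prop)).norm (uc_int n F hF _ (by fun_prop)) ?_
    intro v
    simp only [norm_mul]
    have := uc_cexp_norm n T hT y w v hw s _ hs
    gcongr
    refine this.trans (le_of_eq ?_)
    congr 1
    field_simp
    ring

lemma uc_sup (n : ℕ) (F : EuclideanSpace ℝ (Fin n) → ℂ) (hF : IsTestFun n F)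
    (T : ℝ) (hT : 0 < T) (a : ℝ) (ha : 0 < a) (y : EuclideanSpace ℝ (Fin n)) :
    ‖ucG n T F y‖ ≤ (4 * π * T) ^ (-(n:ℝ) / 2) * ∫ v, Real.exp (a / 4 * ‖v‖) * ‖F v‖ := by
  rw [ucG, norm_mul, Complex.norm_of_nonneg (by positivity)]
  gcongr
  refine (norm_integral_le_integral_norm _).trans ?_
  refine integral_mono (uc_int' n F hF _ (by fun_prop)).norm (uc_int n F hF _ (by fun_prop)) ?_
  intro v
  simp only [norm_mul]
  rw [show -Complex.I * ((⟪y, v⟫ / (2 * T) : ℝ) : ℂ) = ((-(⟪y, v⟫ / (2 * T)) : ℝ) : ℂ) * Complex.I by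
    push_cast; ring, Complex.norm_exp_ofReal_mul_I]
  gcongr
  rw [Real.one_le_exp_iff]
  positivity

lemma uc_lip (n : ℕ) (F : EuclideanSpace ℝ (Fin n) → ℂ) (hF : IsTestFun n F)
    (T : ℝ) (hT : 0 < T) (a : ℝ) (ha : 0 < a) (x y : EuclideanSpace ℝ (Fin n)) :
    ‖ucG n T F x - ucG n T F y‖ ≤ 2 * ‖x - y‖ / (a * T) *
      ((4 * π * T) ^ (-(n:ℝ) / 2) * ∫ v, Real.exp (a / 4 * ‖v‖) * ‖F v‖) := by
  rw [ucG, ucG, ← mul_sub, norm_mul, Complex.norm_of_nonneg (by positivity), mul_left_comm]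
  gcongr
  rw [← integral_sub (uc_int' n F hF _ (by fun_prop)) (uc_int' n F hF _ (by fun_prop)),
    ← integral_const_mul]
  refine (norm_integral_le_integral_norm _).trans ?_
  refine integral_mono ((uc_int' n F hF _ (by fun_prop)).sub (uc_int' n F hF _ (by fun_prop))).norm
    ((uc_int n F hF _ (by fun_prop)).const_mul _) ?_
  intro v
  simp only
  rw [← sub_mul, norm_mul, ← mul_assoc]
  gcongr
  have e : Complex.exp (-Complex.I * ((⟪x, v⟫ / (2 * T) : ℝ) : ℂ)) -
      Complex.exp (-Complex.I * ((⟪y, v⟫ / (2 * T) : ℝ) : ℂ)) =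
      Complex.exp (((-(⟪y, v⟫ / (2 * T)) : ℝ) : ℂ) * Complex.I) *
        (Complex.exp (Complex.I * ((-(⟪x - y, v⟫ / (2 * T)) : ℝ) : ℂ)) - 1) := by
    rw [mul_sub, ← Complex.exp_add, mul_one, inner_sub_left]
    congr 2 <;> push_cast <;> ring
  rw [e, norm_mul, Complex.norm_exp_ofReal_mul_I, one_mul]
  refine Real.norm_exp_I_mul_ofReal_sub_one_le.trans ?_
  rw [norm_neg, norm_div, Real.norm_of_nonneg (show 0 ≤ 2 * T by positivity), Real.norm_eq_abs]
  have h1 := abs_real_inner_le_norm (x - y) v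
  have h2 := Real.add_one_le_exp (a / 4 * ‖v‖)
  have h3 : ‖v‖ ≤ 4 / a * Real.exp (a / 4 * ‖v‖) := by
    rw [div_mul_eq_mul_div, le_div_iff₀ ha]
    linarith
  calc |⟪x - y, v⟫| / (2 * T) ≤ ‖x - y‖ * (4 / a * Real.exp (a / 4 * ‖v‖)) / (2 * T) := by
        gcongr
        exact h1.trans (by gcongr)
    _ = _ := by field_simp; norm_num

lemma uc_exp_integrable (n : ℕ) :
    Integrable (fun v : EuclideanSpace ℝ (Fin n) => Real.exp (-(1/2) * ‖v‖)) := by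
  obtain ⟨M, hM⟩ : ∃ M : ℝ, ∀ t : ℝ, 0 ≤ t → Real.exp (-(1/2) * t) ≤ M * (1 + t) ^ (-((n : ℝ) + 1)) := by
    refine ⟨(n+1).factorial * 2 ^ (n+1) * Real.exp (1/2), fun t ht => ?_⟩
    have h1 := Real.pow_div_factorial_le_exp ((1 + t) / 2) (by positivity) (n+1)
    have h2 : (1 + t) ^ (-((n : ℝ) + 1)) = ((1 + t) ^ (n+1))⁻¹ := by
      rw [Real.rpow_neg (by positivity), ← Real.rpow_natCast]
      push_cast; rfl
    rw [h2, ← div_eq_mul_inv, le_div_iff₀ (by positivity)]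
    rw [div_le_iff₀ (by positivity), div_pow, div_le_iff₀ (by positivity)] at h1
    calc Real.exp (-(1/2) * t) * (1 + t) ^ (n+1) ≤ Real.exp (-(1/2) * t) *
          (Real.exp ((1 + t) / 2) * (n+1).factorial * 2 ^ (n+1)) := by gcongr
      _ = (Real.exp (-(1/2) * t) * Real.exp ((1 + t) / 2)) * ((n+1).factorial * 2 ^ (n+1)) := by ring
      _ = Real.exp (1/2) * ((n+1).factorial * 2 ^ (n+1)) := by
        rw [← Real.exp_add]; congr 2; ring
      _ = _ := by ring
  refine ((integrable_one_add_norm (r := (n:ℝ)+1) (by simp)).const_mul M).mono'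
    (Continuous.aestronglyMeasurable (by fun_prop)) (Eventually.of_forall fun v => ?_)
  rw [Real.norm_of_nonneg (Real.exp_pos _).le]
  exact hM _ (norm_nonneg _)

lemma uc_cs (n : ℕ) (F : EuclideanSpace ℝ (Fin n) → ℂ) (hF : IsTestFun n F) (a : ℝ) (ha : 0 < a) :
    (∫ v, Real.exp (a / 4 * ‖v‖) * ‖F v‖) ^ 2 ≤
      (a ^ n)⁻¹ * (∫ v : EuclideanSpace ℝ (Fin n), Real.exp (-(1/2) * ‖v‖)) *
        ∫ v, Real.exp (a * ‖v‖) * ‖F v‖ ^ 2 := by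
  have hFc := hF.1.continuous
  have e1 : ∀ v : EuclideanSpace ℝ (Fin n), Real.exp (-(a / 4) * ‖v‖) ^ 2 = Real.exp (-(1/2) * ‖a • v‖) := by
    intro v
    rw [← Real.exp_nat_mul, norm_smul, Real.norm_of_nonneg ha.le]
    congr 1
    push_cast; ring
  have e2 : ∀ v : EuclideanSpace ℝ (Fin n), (Real.exp (a / 2 * ‖v‖) * ‖F v‖) ^ 2 = Real.exp (a * ‖v‖) * ‖F v‖ ^ 2 := by
    intro v
    rw [mul_pow, ← Real.exp_nat_mul]
    congr 2
    push_cast; ring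
  have h := integral_mul_le_Lp_mul_Lq_of_nonneg (μ := (volume : Measure (EuclideanSpace ℝ (Fin n))))
    (p := 2) (q := 2) Real.HolderConjugate.two_two
    (f := fun v => Real.exp (-(a / 4) * ‖v‖)) (g := fun v => Real.exp (a / 2 * ‖v‖) * ‖F v‖)
    (Eventually.of_forall fun v => by positivity) (Eventually.of_forall fun v => by positivity)
    (by
      rw [ENNReal.ofReal_ofNat, memLp_two_iff_integrable_sq (Continuous.aestronglyMeasurable (by fun_prop))]
      simp_rw [e1]
      exact (uc_exp_integrable n).comp_smul ha.ne')
    (by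
      rw [ENNReal.ofReal_ofNat]
      exact Continuous.memLp_of_hasCompactSupport (by fun_prop) hF.2.norm.mul_left)
  have e3 : ∀ v : EuclideanSpace ℝ (Fin n), Real.exp (-(a / 4) * ‖v‖) * (Real.exp (a / 2 * ‖v‖) * ‖F v‖) =
      Real.exp (a / 4 * ‖v‖) * ‖F v‖ := by
    intro v
    rw [← mul_assoc, ← Real.exp_add]
    congr 2
    ring
  simp_rw [e3, Real.rpow_two, e1, e2] at h
  rw [Measure.integral_comp_smul volume (fun v : EuclideanSpace ℝ (Fin n) => Real.exp (-(1/2) * ‖v‖)),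
    finrank_euclideanSpace, Fintype.card_fin, smul_eq_mul, abs_of_pos (by positivity),
    ← Real.sqrt_eq_rpow, ← Real.sqrt_eq_rpow, ← Real.sqrt_mul (by positivity)] at h
  have h0 : 0 ≤ ∫ v, Real.exp (a / 4 * ‖v‖) * ‖F v‖ := by positivity
  calc _ ≤ (Real.sqrt _) ^ 2 := by gcongr
    _ = _ := Real.sq_sqrt (by positivity)


lemma uc_small (n : ℕ) (g : EuclideanSpace ℝ (Fin n) → ℂ) (K ρ r : ℝ) (hK : 0 < K) (hρ : 0 < ρ)
    (hr : ρ ≤ r) (hsup : ∀ x, ‖g x‖ ≤ K) (hlip : ∀ x y, ‖g x - g y‖ ≤ 2 * ‖x - y‖ / ρ * K)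
    (hint : Integrable (fun x => ‖g x‖ ^ 2)) (x₀ y : EuclideanSpace ℝ (Fin n))
    (hy : ‖y - x₀‖ ≤ ρ / 2) :
    (‖g y‖ / K) ^ (n + 2) ≤ 4 ^ (n + 1) * (∫ x in closedBall x₀ r, ‖g x‖ ^ 2) /
      (volume.real (ball (0 : EuclideanSpace ℝ (Fin n)) 1) * ρ ^ n * K ^ 2) := by
  set ω := volume.real (ball (0 : EuclideanSpace ℝ (Fin n)) 1) with hω
  have hωpos : 0 < ω := by
    rw [hω, measureReal_def]
    exact ENNReal.toReal_pos (measure_ball_pos volume _ one_pos).ne' measure_ball_lt_top.ne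
  set m := ∫ x in closedBall x₀ r, ‖g x‖ ^ 2 with hm
  set δ := ρ * ‖g y‖ / (4 * K) with hδ
  have hδ0 : 0 ≤ δ := by positivity
  have hδ1 : δ ≤ ρ / 4 := by
    rw [hδ, div_le_div_iff₀ (by positivity) (by norm_num)]
    have := hsup y
    nlinarith
  have hsub : closedBall y δ ⊆ closedBall x₀ r := by
    apply closedBall_subset_closedBall'
    rw [dist_eq_norm]
    linarith
  have h1 : ∫ x in closedBall y δ, ‖g x‖ ^ 2 ≤ m :=
    setIntegral_mono_set hint.integrableOn (Eventually.of_forall fun x => by positivity)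
      (LE.le.eventuallyLE hsub)
  have h2 : ∫ x in closedBall y δ, (‖g y‖ / 2) ^ 2 ≤ ∫ x in closedBall y δ, ‖g x‖ ^ 2 := by
    refine setIntegral_mono_on (integrableOn_const (by
      exact measure_closedBall_lt_top.ne)) hint.integrableOn measurableSet_closedBall ?_
    intro x hx
    have hxy : ‖x - y‖ ≤ δ := by simpa [dist_eq_norm] using hx
    have h3 := hlip x y
    have h4 : 2 * ‖x - y‖ / ρ * K ≤ 2 * δ / ρ * K := by gcongr
    have h5 : 2 * δ / ρ * K = ‖g y‖ / 2 := by rw [hδ]; field_simp; ring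
    have h6 := norm_sub_norm_le (g y) (g x)
    rw [norm_sub_rev] at h6
    have h7 : ‖g y‖ / 2 ≤ ‖g x‖ := by linarith
    gcongr
  rw [setIntegral_const, Measure.addHaar_real_closedBall _ _ hδ0, finrank_euclideanSpace,
    Fintype.card_fin, ← hω, smul_eq_mul] at h2
  have h3 := h2.trans h1
  rw [le_div_iff₀ (by positivity)]
  have e : δ ^ n * ω * (‖g y‖ / 2) ^ 2 * 4 ^ (n + 1) = (‖g y‖ / K) ^ (n + 2) * (ω * ρ ^ n * K ^ 2) := by
    rw [hδ]
    simp only [div_pow, mul_pow]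
    field_simp
    ring
  nlinarith [pow_pos (show (0:ℝ) < 4 by norm_num) (n+1)]

lemma uc_numeric (n : ℕ) (C t D l p : ℝ) (hC : 128 + 64 * ((n:ℝ) + 2) ≤ C) (ht : 0 ≤ t)
    (hD : 0 ≤ D) (hl : C * (1 + D) ≤ l) (hp3 : 2 ≤ p)
    (hp : p ≤ ((n:ℝ) + 2) * Real.exp (32 * (l * t + D) + 1)) :
    (p + 2) * l ≤ Real.exp (l * (1 + C * t)) := by
  have hn : (0:ℝ) ≤ n := by positivity
  have hCl : C ≤ l := by nlinarith
  have hl0 : 0 ≤ l := by linarith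
  have h1 : l ≤ 4 * Real.exp (l / 4) := by
    have := Real.add_one_le_exp (l / 4); linarith
  have h2 : 24 * ((n:ℝ) + 2) ≤ Real.exp (l / 2) := by
    have := Real.add_one_le_exp (l / 2); linarith
  have h3 : 32 * D ≤ l / 4 := by nlinarith
  have h4 : Real.exp (32 * (l * t + D) + 1) ≤ 3 * Real.exp (32 * (l * t) + l / 4) := by
    have e1 := Real.exp_one_lt_d9
    calc Real.exp (32 * (l * t + D) + 1) = Real.exp 1 * Real.exp (32 * (l * t + D)) := by
          rw [← Real.exp_add]; congr 1; ring
      _ ≤ 3 * Real.exp (32 * (l * t) + l / 4) := by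
          gcongr
          · linarith
          · linarith
  have h5 : 32 * (l * t) ≤ l * (C * t) := by
    have : 0 ≤ l * t := by positivity
    nlinarith
  calc (p + 2) * l ≤ (2 * p) * l := by gcongr; linarith
    _ ≤ (2 * (((n:ℝ) + 2) * (3 * Real.exp (32 * (l * t) + l / 4)))) * (4 * Real.exp (l / 4)) := by
        gcongr
        exact hp.trans (by gcongr)
    _ = (24 * ((n:ℝ) + 2)) * (Real.exp (32 * (l * t) + l / 4) * Real.exp (l / 4)) := by ring
    _ ≤ Real.exp (l / 2) * (Real.exp (32 * (l * t) + l / 4) * Real.exp (l / 4)) := by gcongr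
    _ = Real.exp (32 * (l * t) + l) := by
        rw [← Real.exp_add, ← Real.exp_add]; congr 1; ring
    _ ≤ Real.exp (l * (1 + C * t)) := by
        apply Real.exp_le_exp.mpr; linarith

set_option maxHeartbeats 2000000 in
lemma uc_core (n : ℕ) (g : EuclideanSpace ℝ (Fin n) → ℂ) (J A ρ r b : ℝ) (hJ : 0 < J) (hA : 0 < A)
    (hρ : 0 < ρ) (hr : ρ ≤ r) (hb : 0 < b) (K : ℝ) (hK : 0 < K) (hKsq : K ^ 2 = J * A / ρ ^ n)
    (hg : ∀ y w : EuclideanSpace ℝ (Fin n), ‖w‖ = 1 → ∃ H : ℂ → ℂ, Differentiable ℂ H ∧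
      (∀ t : ℝ, H t = g (y + t • w)) ∧ ∀ s : ℂ, |s.im| ≤ ρ / 2 → ‖H s‖ ≤ K)
    (hsup : ∀ x, ‖g x‖ ≤ K) (hlip : ∀ x y, ‖g x - g y‖ ≤ 2 * ‖x - y‖ / ρ * K)
    (hint : Integrable (fun x => ‖g x‖ ^ 2)) (hgA : ∫ x, ‖g x‖ ^ 2 ≤ A)
    (x₀ x' : EuclideanSpace ℝ (Fin n)) (ε C ω : ℝ) (hε0 : 0 < ε) (hε1 : ε < 1)
    (hω : ω = volume.real (ball (0 : EuclideanSpace ℝ (Fin n)) 1))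
    (hC : 128 + 64 * ((n:ℝ) + 2) ≤ C)
    (hl : C * (1 + (‖x₀ - x'‖ + r + b⁻¹) / ρ) ≤ -Real.log ε) :
    (∫ x, Real.exp (-b * ‖x - x'‖) * ‖g x‖ ^ 2) ≤ 
      (1 + ω * J * (2 * n).factorial) * (ε * A) +
      ((2 * n).factorial * 4 ^ (n + 1)) * (ε * Real.exp (ε ^ (-1 - C * b⁻¹ / ρ)) *
        ∫ x in closedBall x₀ r, ‖g x‖ ^ 2) := by
  have hωpos : 0 < ω := by
    rw [hω, measureReal_def]
    exact ENNReal.toReal_pos (measure_ball_pos volume _ one_pos).ne' measure_ball_lt_top.ne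
  set m := ∫ x in closedBall x₀ r, ‖g x‖ ^ 2 with hm
  have hm0 : 0 ≤ m := by positivity
  set l := -Real.log ε with hldef
  have hεl : ε = Real.exp (-l) := by rw [hldef, neg_neg, Real.exp_log hε0]
  set t := b⁻¹ / ρ with htdef
  set D := ‖x₀ - x'‖ / ρ with hDdef
  have ht0 : 0 ≤ t := by positivity
  have hD0 : 0 ≤ D := by positivity
  have hn0 : (0:ℝ) ≤ n := by positivity
  have hC1 : 1 ≤ C := by linarith
  have hr0 : 0 ≤ r / ρ := div_nonneg (hρ.le.trans hr) hρ.le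
  have hsplit : (‖x₀ - x'‖ + r + b⁻¹) / ρ = D + r / ρ + t := by rw [hDdef, htdef]; ring
  rw [hsplit] at hl
  have hlD : C * (1 + D) ≤ l := by
    refine le_trans ?_ hl
    exact mul_le_mul_of_nonneg_left (by linarith) (by linarith)
  have hlt : t ≤ l := by
    refine le_trans ?_ hl
    have h9 : 1 + (D + r / ρ + t) ≤ C * (1 + (D + r / ρ + t)) :=
      le_mul_of_one_le_left (by linarith) hC1
    linarith
  have hl0 : 0 ≤ l := ht0.trans hlt
  set R := l / b with hRdef
  have hR0 : 0 ≤ R := by positivity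
  have hRρ : R / ρ = l * t := by rw [hRdef, htdef]; field_simp
  -- the number of steps
  set N := ⌈32 * (l * t + D)⌉₊ with hN
  have hN1 : 32 * (l * t + D) ≤ N := Nat.le_ceil _
  have hN2 : (N : ℝ) ≤ 32 * (l * t + D) + 1 := (Nat.ceil_lt_add_one (by positivity)).le
  set p := (n + 2) * 2 ^ N with hp
  set σ := 4 ^ (n + 1) * m / (ω * J * A) with hσ
  have hσ0 : 0 ≤ σ := by positivity
  have hωK : ω * ρ ^ n * K ^ 2 = ω * J * A := by rw [hKsq]; field_simp
  have hprop : ∀ x ∈ closedBall x' R, (‖g x‖ / K) ^ p ≤ σ := by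
    intro x hx
    have h := uc_propagation (fun x => g x / (K : ℂ)) (ρ / 4) (by positivity) (by
      intro y w hw
      obtain ⟨H, h1, h2, h3⟩ := hg y w hw
      refine ⟨fun s => H s / (K : ℂ), h1.div_const _, fun s => by simp only [h2], fun s hs => ?_⟩
      rw [norm_div, Complex.norm_of_nonneg hK.le, div_le_one hK]
      exact h3 s (by linarith)) (by
      intro x
      rw [norm_div, Complex.norm_of_nonneg hK.le, div_le_one hK]
      exact hsup x) x₀ (n + 2) σ (by
      intro x hx
      rw [norm_div, Complex.norm_of_nonneg hK.le]
      have := uc_small n g K ρ r hK hρ hr hsup hlip hint x₀ x (by linarith)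
      rw [← hω, hωK] at this
      exact this) N x (by
      have h1 : ‖x - x'‖ ≤ R := by simpa [dist_eq_norm] using hx
      have h2 : ‖x - x₀‖ ≤ ‖x - x'‖ + ‖x₀ - x'‖ := by
        rw [norm_sub_rev x₀ x']
        exact norm_sub_le_norm_sub_add_norm_sub _ _ _
      have h3 : R = l * t * ρ := by rw [← hRρ]; field_simp
      have h4 : ‖x₀ - x'‖ = D * ρ := by rw [hDdef]; field_simp
      have h5 : 32 * (l * t + D) * ρ ≤ N * ρ := mul_le_mul_of_nonneg_right hN1 hρ.le
      linarith)
    rw [norm_div, Complex.norm_of_nonneg hK.le] at h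
    exact h
  have hpt : ∀ x ∈ closedBall x' R, ‖g x‖ ^ 2 ≤ K ^ 2 * (ε ^ 2 + (ε ^ p)⁻¹ * σ) := by
    intro x hx
    have h1 := hprop x hx
    set f := ‖g x‖ / K with hf
    have hf0 : 0 ≤ f := by positivity
    have hf1 : f ≤ 1 := by rw [hf, div_le_one hK]; exact hsup x
    have hgf : ‖g x‖ = K * f := by rw [hf]; field_simp
    rw [hgf, mul_pow]
    gcongr
    by_cases hfe : f ≤ ε
    · have : f ^ 2 ≤ ε ^ 2 := by gcongr
      have : 0 ≤ (ε ^ p)⁻¹ * σ := by positivity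
      linarith
    · push Not at hfe
      have h2 : f ^ 2 ≤ 1 := pow_le_one₀ hf0 hf1
      have h3 : 1 ≤ (ε ^ p)⁻¹ * σ := by
        rw [← div_eq_inv_mul, le_div_iff₀ (by positivity), one_mul]
        refine le_trans ?_ h1
        gcongr
      have : 0 ≤ ε ^ 2 := by positivity
      linarith
  -- splitting of the integral
  have hwint : Integrable (fun x => Real.exp (-b * ‖x - x'‖) * ‖g x‖ ^ 2) := by
    refine hint.mono' (AEStronglyMeasurable.mul (Continuous.aestronglyMeasurable (by fun_prop))
      hint.aestronglyMeasurable) (Eventually.of_forall fun x => ?_)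
    rw [Real.norm_of_nonneg (by positivity)]
    refine mul_le_of_le_one_left (by positivity) (Real.exp_le_one_iff.mpr ?_)
    have : 0 ≤ b * ‖x - x'‖ := by positivity
    linarith
  have hin : ∫ x in closedBall x' R, Real.exp (-b * ‖x - x'‖) * ‖g x‖ ^ 2 ≤
      R ^ n * ω * (K ^ 2 * (ε ^ 2 + (ε ^ p)⁻¹ * σ)) := by
    have : ∫ x in closedBall x' R, Real.exp (-b * ‖x - x'‖) * ‖g x‖ ^ 2 ≤
        ∫ x in closedBall x' R, K ^ 2 * (ε ^ 2 + (ε ^ p)⁻¹ * σ) := by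
      refine setIntegral_mono_on hwint.integrableOn
        (integrableOn_const measure_closedBall_lt_top.ne) measurableSet_closedBall ?_
      intro x hx
      refine le_trans ?_ (hpt x hx)
      refine mul_le_of_le_one_left (by positivity) (Real.exp_le_one_iff.mpr ?_)
      have : 0 ≤ b * ‖x - x'‖ := by positivity
      linarith
    rwa [setIntegral_const, Measure.addHaar_real_closedBall _ _ hR0, finrank_euclideanSpace,
      Fintype.card_fin, ← hω, smul_eq_mul] at this
  have hout : ∫ x in (closedBall x' R)ᶜ, Real.exp (-b * ‖x - x'‖) * ‖g x‖ ^ 2 ≤ ε * A := by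
    calc ∫ x in (closedBall x' R)ᶜ, Real.exp (-b * ‖x - x'‖) * ‖g x‖ ^ 2
        ≤ ∫ x in (closedBall x' R)ᶜ, ε * ‖g x‖ ^ 2 := by
          refine setIntegral_mono_on hwint.integrableOn (hint.const_mul _).integrableOn
            measurableSet_closedBall.compl ?_
          intro x hx
          have h1 : R < ‖x - x'‖ := by simpa [dist_eq_norm] using hx
          gcongr
          rw [hεl]
          apply Real.exp_le_exp.mpr
          have h2 : b * R = l := by rw [hRdef]; field_simp
          have h3 : b * R ≤ b * ‖x - x'‖ := mul_le_mul_of_nonneg_left h1.le hb.le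
          linarith
      _ ≤ ∫ x, ε * ‖g x‖ ^ 2 :=
          setIntegral_le_integral (hint.const_mul _) (Eventually.of_forall fun x => by positivity)
      _ ≤ ε * A := by rw [integral_const_mul]; gcongr
  have hexpl : Real.exp l * ε = 1 := by rw [hεl, ← Real.exp_add]; simp
  have hfac : (l * t) ^ n ≤ (2 * n).factorial * Real.exp l := by
    calc (l * t) ^ n ≤ (l * l) ^ n := by gcongr
      _ = l ^ (2 * n) := by rw [pow_mul]; ring
      _ ≤ (2 * n).factorial * Real.exp l := by
        have := Real.pow_div_factorial_le_exp l hl0 (2 * n)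
        rwa [div_le_iff₀ (by positivity), mul_comm (Real.exp l)] at this
  have hp2 : 2 ≤ (p : ℝ) := by
    rw [hp]; push_cast
    have : (1:ℝ) ≤ 2 ^ N := one_le_pow₀ (by norm_num)
    nlinarith
  have hpexp : (p : ℝ) ≤ ((n:ℝ) + 2) * Real.exp (32 * (l * t + D) + 1) := by
    rw [hp]; push_cast
    gcongr
    calc (2:ℝ) ^ N ≤ Real.exp 1 ^ N := by
          gcongr
          have := Real.exp_one_gt_d9; linarith
      _ = Real.exp N := by rw [← Real.exp_nat_mul, mul_one]
      _ ≤ _ := Real.exp_le_exp.mpr hN2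
  have hnum := uc_numeric n C t D l p hC ht0 hD0 hlD hp2 hpexp
  have hbig : Real.exp l * (ε ^ p)⁻¹ ≤ ε * Real.exp (ε ^ (-1 - C * b⁻¹ / ρ)) := by
    have e1 : ε ^ (-1 - C * b⁻¹ / ρ) = Real.exp (l * (1 + C * t)) := by
      rw [hεl, ← Real.exp_mul, htdef]
      congr 1
      ring
    have e2 : (ε ^ p)⁻¹ = Real.exp (p * l) := by
      rw [hεl, ← Real.exp_nat_mul, ← Real.exp_neg]
      congr 1; ring
    rw [e1, e2]
    have e3 : ∀ X : ℝ, ε * X = Real.exp (-l) * X := fun X => by rw [← hεl]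
    rw [e3, ← Real.exp_add, ← Real.exp_add]
    apply Real.exp_le_exp.mpr
    linarith
  have hmid : R ^ n * ω * (K ^ 2 * (ε ^ 2 + (ε ^ p)⁻¹ * σ)) =
      (l * t) ^ n * (ω * J * A * ε ^ 2 + (ε ^ p)⁻¹ * (4 ^ (n + 1) * m)) := by
    have hRn : R ^ n = ρ ^ n * (l * t) ^ n := by
      rw [← hRρ, ← mul_pow, mul_div_cancel₀ _ hρ.ne']
    rw [hRn, hKsq, hσ]
    generalize l * t = q
    field_simp
  have hfin : R ^ n * ω * (K ^ 2 * (ε ^ 2 + (ε ^ p)⁻¹ * σ)) ≤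
      (ω * J * (2 * n).factorial) * (ε * A) +
      ((2 * n).factorial * 4 ^ (n + 1)) * (ε * Real.exp (ε ^ (-1 - C * b⁻¹ / ρ)) * m) := by
    rw [hmid]
    calc (l * t) ^ n * (ω * J * A * ε ^ 2 + (ε ^ p)⁻¹ * (4 ^ (n + 1) * m))
        ≤ ((2 * n).factorial * Real.exp l) *
          (ω * J * A * ε ^ 2 + (ε ^ p)⁻¹ * (4 ^ (n + 1) * m)) := by gcongr
      _ = (ω * J * (2 * n).factorial) * ((Real.exp l * ε) * ε * A) +
          ((2 * n).factorial * 4 ^ (n + 1)) * ((Real.exp l * (ε ^ p)⁻¹) * m) := by ring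
      _ ≤ _ := by
        rw [hexpl, one_mul]
        gcongr
  rw [← integral_add_compl measurableSet_closedBall hwint (s := closedBall x' R)]
  linarith

set_option maxHeartbeats 2000000 in
lemma uc_final (n : ℕ) :
    ∃ C > (0 : ℝ),
      ∀ (x₀ x' : EuclideanSpace ℝ (Fin n)) (r a b T : ℝ),
        0 < r → 0 < a → 0 < b → 0 < T →
          ∀ u₀ : EuclideanSpace ℝ (Fin n) → ℂ, IsTestFun n u₀ →
            ∀ ε : ℝ, ε ∈ Set.Ioo (0 : ℝ) 1 →
              (∫ x, Real.exp (-b * ‖x - x'‖) * ‖schrodingerSol n u₀ T x‖ ^ 2) ≤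
                Real.exp (C * (1 + (‖x₀ - x'‖ + r + b⁻¹) / min (a * T) r)) *
                  (ε * (∫ x, Real.exp (a * ‖x‖) * ‖u₀ x‖ ^ 2) +
                    ε * Real.exp (ε ^ (-1 - C * b⁻¹ / min (a * T) r)) *
                      ∫ x in closedBall x₀ r, ‖schrodingerSol n u₀ T x‖ ^ 2) := by
  set ω := volume.real (ball (0 : EuclideanSpace ℝ (Fin n)) 1) with hω
  set J := ∫ v : EuclideanSpace ℝ (Fin n), Real.exp (-(1/2) * ‖v‖) with hJ
  have hω0 : 0 ≤ ω := by positivity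
  have hJ0 : 0 < J := integral_exp_pos (uc_exp_integrable n)
  set C : ℝ := 128 + 64 * ((n:ℝ) + 2) + (1 + ω * J * (2 * n).factorial) +
    ((2 * n).factorial * 4 ^ (n + 1)) with hC
  have hc1 : 0 ≤ ω * J * (2 * n).factorial := by positivity
  have hc2 : (0:ℝ) ≤ (2 * n).factorial * 4 ^ (n + 1) := by positivity
  have hn0 : (0:ℝ) ≤ n := by positivity
  have hCpos : 0 < C := by linarith
  refine ⟨C, hCpos, ?_⟩
  intro x₀ x' r a b T hr ha hb hT u₀ hu ε hε
  obtain ⟨hε0, hε1⟩ := hε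
  set ρ := min (a * T) r with hρdef
  have hρ : 0 < ρ := lt_min (by positivity) hr
  have hρr : ρ ≤ r := min_le_right _ _
  have hρa : ρ ≤ a * T := min_le_left _ _
  set F : EuclideanSpace ℝ (Fin n) → ℂ :=
    fun v => Complex.exp (Complex.I * ((‖v‖ ^ 2 / (4 * T) : ℝ) : ℂ)) * u₀ v with hFdef
  have hF : IsTestFun n F := uc_modulate n u₀ hu T
  have hFn : ∀ v, ‖u₀ v‖ = ‖F v‖ := by
    intro v
    rw [hFdef]
    simp only [norm_mul]
    rw [mul_comm Complex.I, Complex.norm_exp_ofReal_mul_I, one_mul]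
  simp_rw [uc_rep' n u₀ hu T hT, hFn]
  rw [← hFdef]
  set g := ucG n T F with hg
  set A := ∫ x, Real.exp (a * ‖x‖) * ‖F x‖ ^ 2 with hA
  set m := ∫ x in closedBall x₀ r, ‖g x‖ ^ 2 with hm
  have hm0 : 0 ≤ m := by positivity
  have hA0 : 0 ≤ A := by positivity
  obtain ⟨hint, hpl⟩ := uc_plancherel n F hF T hT
  have hFc := hF.1.continuous
  have hAint : Integrable (fun x => Real.exp (a * ‖x‖) * ‖F x‖ ^ 2) := by
    refine Continuous.integrable_of_hasCompactSupport (by fun_prop) ?_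
    have := uc_int
    have h2 : HasCompactSupport (fun x => ‖F x‖ * ‖F x‖) := hF.2.norm.mul_left
    simp_rw [← sq] at h2
    exact h2.mul_left
  have hgA : ∫ x, ‖g x‖ ^ 2 ≤ A := by
    rw [hpl]
    refine integral_mono_of_nonneg (Eventually.of_forall fun x => by positivity) hAint
      (Eventually.of_forall fun x => ?_)
    refine le_mul_of_one_le_left (by positivity) (Real.one_le_exp_iff.mpr (by positivity))
  have hLA : (∫ x, Real.exp (-b * ‖x - x'‖) * ‖g x‖ ^ 2) ≤ A := by
    refine le_trans ?_ hgA
    refine integral_mono_of_nonneg (Eventually.of_forall fun x => by positivity) hint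
      (Eventually.of_forall fun x => ?_)
    refine mul_le_of_le_one_left (by positivity) (Real.exp_le_one_iff.mpr ?_)
    have : 0 ≤ b * ‖x - x'‖ := by positivity
    linarith
  set P := Real.exp (C * (1 + (‖x₀ - x'‖ + r + b⁻¹) / ρ)) with hP
  have hP0 : 0 < P := Real.exp_pos _
  set Z := ε * Real.exp (ε ^ (-1 - C * b⁻¹ / ρ)) * m with hZ
  have hZ0 : 0 ≤ Z := by positivity
  by_cases htriv : A = 0 ∨ 1 ≤ P * ε
  · refine hLA.trans ?_
    have h1 : A ≤ P * (ε * A) := by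
      rcases htriv with h | h
      · rw [h]; simp
      · rw [← mul_assoc]; exact le_mul_of_one_le_left hA0 h
    have h2 : 0 ≤ P * Z := by positivity
    rw [mul_add]
    linarith
  push Not at htriv
  obtain ⟨hAne, hPε⟩ := htriv
  have hApos : 0 < A := lt_of_le_of_ne hA0 (Ne.symm hAne)
  have hl : C * (1 + (‖x₀ - x'‖ + r + b⁻¹) / ρ) ≤ -Real.log ε := by
    have h1 := Real.log_lt_log (by positivity) hPε
    rw [Real.log_mul hP0.ne' hε0.ne', hP, Real.log_exp, Real.log_one] at h1
    linarith
  -- the constant K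
  set K := Real.sqrt (J * A / ρ ^ n) with hK
  have hKpos : 0 < K := Real.sqrt_pos.mpr (by positivity)
  have hKsq : K ^ 2 = J * A / ρ ^ n := Real.sq_sqrt (by positivity)
  set K₁ := (4 * π * T) ^ (-(n:ℝ) / 2) * ∫ v, Real.exp (a / 4 * ‖v‖) * ‖F v‖ with hK₁
  have hK₁0 : 0 ≤ K₁ := by positivity
  have hKK : K₁ ≤ K := by
    apply Real.le_sqrt_of_sq_le
    rw [hK₁, mul_pow, uc_const_sq n T hT]
    have h1 := uc_cs n F hF a ha
    rw [← hJ, ← hA] at h1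
    calc ((4 * π * T) ^ n)⁻¹ * (∫ v, Real.exp (a / 4 * ‖v‖) * ‖F v‖) ^ 2
        ≤ ((4 * π * T) ^ n)⁻¹ * ((a ^ n)⁻¹ * J * A) := by gcongr
      _ = J * A / (4 * π * (a * T)) ^ n := by
        rw [← mul_assoc (4 * π), mul_right_comm (4 * π) a T, mul_pow (4 * π * T) a]
        field_simp
      _ ≤ J * A / ρ ^ n := by
        gcongr
        have := Real.pi_gt_three
        nlinarith [mul_pos ha hT]
  have hcore := uc_core n g J A ρ r b hJ0 hApos hρ hρr hb K hKpos hKsq (by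
      intro y w hw
      obtain ⟨H, h1, h2, h3⟩ := uc_ext n F hF T hT a y w hw
      exact ⟨H, h1, h2, fun s hs => (h3 s (by linarith)).trans hKK⟩)
    (fun x => (uc_sup n F hF T hT a ha x).trans hKK)
    (fun x y => (uc_lip n F hF T hT a ha x y).trans (by
      rw [← hK₁]
      gcongr))
    hint hgA x₀ x' ε C ω hε0 hε1 hω (by linarith) hl
  refine hcore.trans ?_
  have hPC : C ≤ P := by
    have h1 : 0 ≤ (‖x₀ - x'‖ + r + b⁻¹) / ρ := by positivity
    have h2 := Real.add_one_le_exp (C * (1 + (‖x₀ - x'‖ + r + b⁻¹) / ρ))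
    rw [← hP] at h2
    have h3 : C ≤ C * (1 + (‖x₀ - x'‖ + r + b⁻¹) / ρ) :=
      le_mul_of_one_le_right hCpos.le (by linarith)
    linarith
  rw [mul_add]
  have hεA : 0 ≤ ε * A := by positivity
  gcongr
  · linarith
  · linarith

/-- Theorem 1.5: there is `C = C(n) > 0` such that for all `x₀, x' ∈ ℝⁿ`, `r, a, b, T > 0`,
every `u₀ ∈ C₀^∞(ℝⁿ;ℂ)` and every `ε ∈ (0,1)`,
`∫ e^{-b|x-x'|}|u(·,T;u₀)|² ≤ e^{C[1 + (|x₀-x'|+r+b⁻¹)/((aT)∧r)]}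
  (ε ∫ e^{a|x|}|u₀|² + ε e^{ε^{-1-Cb⁻¹/((aT)∧r)}} ∫_{B_r(x₀)}|u(·,T;u₀)|²)`. -/
theorem unique_continuation_weighted (n : ℕ) (hn : 1 ≤ n) :
    ∃ C > (0 : ℝ),
      ∀ (x₀ x' : EuclideanSpace ℝ (Fin n)) (r a b T : ℝ),
        0 < r → 0 < a → 0 < b → 0 < T →
          ∀ u₀ : EuclideanSpace ℝ (Fin n) → ℂ, IsTestFun n u₀ →
            ∀ ε : ℝ, ε ∈ Set.Ioo (0 : ℝ) 1 →
              (∫ x, Real.exp (-b * ‖x - x'‖) * ‖schrodingerSol n u₀ T x‖ ^ 2) ≤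
                Real.exp (C * (1 + (‖x₀ - x'‖ + r + b⁻¹) / min (a * T) r)) *
                  (ε * (∫ x, Real.exp (a * ‖x‖) * ‖u₀ x‖ ^ 2) +
                    ε * Real.exp (ε ^ (-1 - C * b⁻¹ / min (a * T) r)) *
                      ∫ x in closedBall x₀ r, ‖schrodingerSol n u₀ T x‖ ^ 2) := by
  exact uc_final n
end

section
/- For each x₀ ∈ ℝⁿ, r > 0, a > 0 and T > 0, there exist a sequence {u_k} ⊂ C₀^∞(ℝⁿ;ℂ) and a constant M > 0 such that ∫_{ℝⁿ} e^{a|x|} |u_k(x)|² dx ≤ M and ∫_{ℝⁿ} |u_k(x)|² dx = 1 for all k, while ∫_{B_r(x₀)} |u(x,T;u_k)|² dx → 0 as k → ∞. -/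
open MeasureTheory Filter Metric
open scoped Real RealInnerProductSpace ENNReal Topology

theorem aux_ft (n : ℕ) (f : EuclideanSpace ℝ (Fin n) → ℂ) (v ξ : EuclideanSpace ℝ (Fin n)) :
    fourierTransformPaper n (fun x => Complex.exp (Complex.I * (⟪x, v⟫ : ℝ)) * f x) ξ
      = fourierTransformPaper n f (ξ - v) := by
  unfold fourierTransformPaper
  congr 1
  apply integral_congr_ae
  refine Filter.Eventually.of_forall fun x => ?_
  simp only
  rw [← mul_assoc, ← Complex.exp_add, inner_sub_right]
  congr 2
  push_cast
  ring

theorem aux_sol (n : ℕ) (f : EuclideanSpace ℝ (Fin n) → ℂ) (T : ℝ)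
    (v x : EuclideanSpace ℝ (Fin n)) :
    schrodingerSol n (fun x => Complex.exp (Complex.I * (⟪x, v⟫ : ℝ)) * f x) T x
      = Complex.exp (Complex.I * ((⟪x, v⟫ - T * ‖v‖ ^ 2 : ℝ) : ℂ))
        * schrodingerSol n f T (x - (2 * T) • v) := by
  unfold schrodingerSol
  simp only [aux_ft]
  rw [mul_left_comm]
  congr 1
  rw [← integral_add_right_eq_self _ v, ← integral_const_mul]
  apply integral_congr_ae
  refine Filter.Eventually.of_forall fun ξ => ?_
  simp only [add_sub_cancel_right]
  rw [← mul_assoc, ← Complex.exp_add, ← mul_add, ← Complex.ofReal_add]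
  congr 4
  rw [norm_add_sq_real, inner_add_right, inner_sub_left, inner_smul_left, real_inner_comm v ξ]
  simp
  ring

theorem aux_zero (n : ℕ) (f : EuclideanSpace ℝ (Fin n) → ℂ) (T : ℝ) :
    Tendsto (schrodingerSol n f T) (cocompact (EuclideanSpace ℝ (Fin n))) (𝓝 0) := by
  have h := tendsto_integral_exp_inner_smul_cocompact
    (fun ξ : EuclideanSpace ℝ (Fin n) =>
      Complex.exp (Complex.I * ((- (T * ‖ξ‖ ^ 2) : ℝ) : ℂ)) * fourierTransformPaper n f ξ)
  have hc : (-(2 * π)⁻¹ : ℝ) ≠ 0 := by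
    have := Real.pi_pos
    simp [ne_of_gt this]
  have h2 : Tendsto (fun x : EuclideanSpace ℝ (Fin n) => (-(2 * π)⁻¹ : ℝ) • x)
      (cocompact _) (cocompact _) :=
    (Homeomorph.smulOfNeZero _ hc).isClosedEmbedding.tendsto_cocompact
  have h3 := (h.comp h2).const_mul ((((2 * Real.pi) ^ (-(n : ℝ) / 2) : ℝ) : ℂ))
  rw [mul_zero] at h3
  refine h3.congr fun x => ?_
  unfold schrodingerSol
  congr 1
  apply integral_congr_ae
  refine Filter.Eventually.of_forall fun ξ => ?_
  simp only [Circle.smul_def, Real.fourierChar_apply, smul_eq_mul]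
  rw [← mul_assoc, ← Complex.exp_add]
  congr 2
  rw [inner_smul_right, real_inner_comm ξ x]
  have : (π : ℂ) ≠ 0 := by exact_mod_cast Real.pi_ne_zero
  push_cast
  field_simp
  ring

theorem aux_meas (n : ℕ) (f : EuclideanSpace ℝ (Fin n) → ℂ) (hf : Continuous f) (T : ℝ) :
    StronglyMeasurable (schrodingerSol n f T) := by
  have h1 : StronglyMeasurable (fourierTransformPaper n f) := by
    unfold fourierTransformPaper
    refine StronglyMeasurable.const_mul ?_ _
    refine StronglyMeasurable.integral_prod_right
      (f := fun (ξ x : EuclideanSpace ℝ (Fin n)) =>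
        Complex.exp (-Complex.I * (⟪x, ξ⟫ : ℝ)) * f x) ?_
    apply Continuous.stronglyMeasurable
    simp only [Function.uncurry_def]
    fun_prop
  unfold schrodingerSol
  refine StronglyMeasurable.const_mul ?_ _
  refine StronglyMeasurable.integral_prod_right
    (f := fun (x ξ : EuclideanSpace ℝ (Fin n)) =>
      Complex.exp (Complex.I * ((⟪x, ξ⟫ - T * ‖ξ‖ ^ 2 : ℝ) : ℂ)) * fourierTransformPaper n f ξ) ?_
  simp only [Function.uncurry_def]
  refine StronglyMeasurable.mul ?_ (h1.comp_measurable measurable_snd)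
  apply Continuous.stronglyMeasurable
  fun_prop

theorem aux_bdd (n : ℕ) (f : EuclideanSpace ℝ (Fin n) → ℂ) (T : ℝ) :
    ∃ C : ℝ, ∀ x, ‖schrodingerSol n f T x‖ ≤ C := by
  refine ⟨‖(((2 * Real.pi) ^ (-(n : ℝ) / 2) : ℝ) : ℂ)‖ * ∫ ξ, ‖fourierTransformPaper n f ξ‖,
    fun x => ?_⟩
  unfold schrodingerSol
  rw [norm_mul]
  refine mul_le_mul_of_nonneg_left ?_ (norm_nonneg _)
  refine (norm_integral_le_integral_norm _).trans (le_of_eq ?_)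
  apply integral_congr_ae
  refine Filter.Eventually.of_forall fun ξ => ?_
  simp only [norm_mul]
  rw [mul_comm Complex.I, Complex.norm_exp_ofReal_mul_I, one_mul]

theorem aux_bump (n : ℕ) : ∃ φ : EuclideanSpace ℝ (Fin n) → ℂ,
    ContDiff ℝ (⊤ : ℕ∞) φ ∧ HasCompactSupport φ ∧ (∫ x, ‖φ x‖ ^ 2) = 1 := by
  let b : ContDiffBump (0 : EuclideanSpace ℝ (Fin n)) := default
  have hb : ContDiff ℝ (⊤ : ℕ∞) b := b.contDiff
  have hA : 0 < ∫ x, (b x) ^ 2 := by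
    apply Continuous.integral_pos_of_hasCompactSupport_nonneg_nonzero (x := 0)
    · exact hb.continuous.pow 2
    · exact b.hasCompactSupport.comp_left (g := fun y : ℝ => y ^ 2) (by simp)
    · intro x; positivity
    · have : b 0 = 1 := b.one_of_mem_closedBall (by simpa using b.rIn_pos.le)
      simp [this]
  set A := ∫ x, (b x) ^ 2 with hAdef
  refine ⟨fun x => (((√A)⁻¹ * b x : ℝ) : ℂ), ?_, ?_, ?_⟩
  · exact Complex.ofRealCLM.contDiff.comp (contDiff_const.mul hb)
  · exact b.hasCompactSupport.comp_left (g := fun y : ℝ => (((√A)⁻¹ * y : ℝ) : ℂ)) (by simp)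
  · simp only [Complex.norm_real, Real.norm_eq_abs, sq_abs, mul_pow, inv_pow]
    rw [integral_const_mul, Real.sq_sqrt hA.le, ← hAdef, inv_mul_cancel₀ (ne_of_gt hA)]

/-- Theorem 4.1 (iv): for each `x₀ ∈ ℝⁿ`, `r > 0`, `a > 0` and `T > 0`, there are a sequence
`{u_k} ⊂ C₀^∞(ℝⁿ;ℂ)` and `M > 0` with `∫ e^{a|x|}|u_k|² ≤ M`, `∫|u_k|² = 1` for all `k`, and
`∫_{B_r(x₀)}|u(·,T;u_k)|² → 0`. -/
theorem no_interpolation_interior_ball (n : ℕ) (hn : 1 ≤ n)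
    (x₀ : EuclideanSpace ℝ (Fin n)) (r a T : ℝ) (hr : 0 < r) (ha : 0 < a) (hT : 0 < T) :
    ∃ u : ℕ → EuclideanSpace ℝ (Fin n) → ℂ, ∃ M > (0 : ℝ),
      (∀ k, IsTestFun n (u k)) ∧
      (∀ k, (∫ x, Real.exp (a * ‖x‖) * ‖u k x‖ ^ 2) ≤ M) ∧
      (∀ k, (∫ x, ‖u k x‖ ^ 2) = 1) ∧
      Filter.Tendsto (fun k => ∫ x in closedBall x₀ r, ‖schrodingerSol n (u k) T x‖ ^ 2)
        Filter.atTop (𝓝 0) := by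
  obtain ⟨φ, hφ, hφc, hφ1⟩ := aux_bump n
  let e : EuclideanSpace ℝ (Fin n) := EuclideanSpace.single ⟨0, hn⟩ 1
  have he : ‖e‖ = 1 := by simp [e]
  have hnorm : ∀ (k : ℕ) (x : EuclideanSpace ℝ (Fin n)),
      ‖Complex.exp (Complex.I * (⟪x, (k : ℝ) • e⟫ : ℝ)) * φ x‖ = ‖φ x‖ := by
    intro k x
    rw [norm_mul, mul_comm Complex.I, Complex.norm_exp_ofReal_mul_I, one_mul]
  refine ⟨fun k x => Complex.exp (Complex.I * (⟪x, (k : ℝ) • e⟫ : ℝ)) * φ x,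
    |∫ x, Real.exp (a * ‖x‖) * ‖φ x‖ ^ 2| + 1, by positivity, ?_, ?_, ?_, ?_⟩
  · intro k
    refine ⟨?_, hφc.mul_left⟩
    refine ContDiff.mul ?_ hφ
    refine Complex.contDiff_exp.comp (contDiff_const.mul ?_)
    exact Complex.ofRealCLM.contDiff.comp (contDiff_id.inner ℝ contDiff_const)
  · intro k
    simp only [hnorm]
    linarith [le_abs_self (∫ x, Real.exp (a * ‖x‖) * ‖φ x‖ ^ 2)]
  · intro k
    simp only [hnorm, hφ1]
  · have hn2 : ∀ (k : ℕ) (x : EuclideanSpace ℝ (Fin n)),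
        ‖schrodingerSol n (fun x => Complex.exp (Complex.I * (⟪x, (k : ℝ) • e⟫ : ℝ)) * φ x) T x‖
          = ‖schrodingerSol n φ T (x - (2 * T) • (k : ℝ) • e)‖ := by
      intro k x
      rw [aux_sol, norm_mul, mul_comm Complex.I, Complex.norm_exp_ofReal_mul_I, one_mul]
    simp only [hn2]
    obtain ⟨C, hC⟩ := aux_bdd n φ T
    have h0 : (0 : ℝ) = ∫ x in closedBall x₀ r, (0 : ℝ) := by simp
    rw [h0]
    refine tendsto_integral_of_dominated_convergence (fun _ => C ^ 2) ?_ ?_ ?_ ?_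
    · intro k
      refine StronglyMeasurable.aestronglyMeasurable ?_
      refine StronglyMeasurable.pow (StronglyMeasurable.norm ?_) 2
      exact (aux_meas n φ hφ.continuous T).comp_measurable (by fun_prop)
    · exact integrableOn_const (hs := measure_closedBall_lt_top.ne)
    · intro k
      refine Filter.Eventually.of_forall fun x => ?_
      rw [Real.norm_eq_abs, abs_of_nonneg (by positivity)]
      exact pow_le_pow_left₀ (norm_nonneg _) (hC _) 2
    · refine Filter.Eventually.of_forall fun x => ?_
      have ht : Tendsto (fun k : ℕ => x - (2 * T) • (k : ℝ) • e) atTop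
          (cocompact (EuclideanSpace ℝ (Fin n))) := by
        rw [← Metric.cobounded_eq_cocompact, ← tendsto_norm_atTop_iff_cobounded]
        have hl : Tendsto (fun k : ℕ => (2 * T) * (k : ℝ) - ‖x‖) atTop atTop :=
          tendsto_atTop_add_const_right _ _
            (tendsto_natCast_atTop_atTop.const_mul_atTop (by positivity))
        refine tendsto_atTop_mono (fun k => ?_) hl
        have h1 : ‖(2 * T) • (k : ℝ) • e‖ = 2 * T * k := by
          rw [norm_smul, norm_smul, he, Real.norm_of_nonneg (by positivity),
            Real.norm_of_nonneg (by positivity), mul_one]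
        rw [← h1, norm_sub_rev]
        exact norm_sub_norm_le _ _
      have := (((aux_zero n φ T).comp ht).norm).pow 2
      simpa using this
end

section
/- Let 𝕂 be ℝ or ℂ, let X, Y, Z be Banach spaces over 𝕂 with dual spaces X*, Y*, Z*, and let R : Z → X and O : Z → Y be bounded linear operators with Banach-space adjoints R* : X* → Z* and O* : Y* → Z*. Then the following are equivalent, and when one holds the constant pairs (C₀, ε₀) and (Ĉ₀, ε̂₀) can be chosen equal: (i) there exist Ĉ₀ > 0 and ε̂₀ > 0 such that ‖Rz‖²_X ≤ Ĉ₀ ‖Oz‖²_Y + ε̂₀ ‖z‖²_Z for every z ∈ Z; (ii) there exist C₀ > 0 and ε₀ > 0 such that for each x* ∈ X* there is y* ∈ Y* satisfying (1/C₀) ‖y*‖²_{Y*} + (1/ε₀) ‖R*x* − O*y*‖²_{Z*} ≤ ‖x*‖²_{X*}. -/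
theorem le_of_sq_le_sq_aux {a b : ℝ} (h : a ^ 2 ≤ b ^ 2) (hb : 0 ≤ b) : a ≤ b :=
  (le_abs_self a).trans (abs_le_of_sq_le_sq h hb)

theorem aux_norm {𝕂 Y Z : Type*} [RCLike 𝕂]
    [NormedAddCommGroup Y] [NormedSpace 𝕂 Y] [NormedAddCommGroup Z] [NormedSpace 𝕂 Z]
    (a : Y →L[𝕂] 𝕂) (b : Z →L[𝕂] 𝕂) (G : ℝ) (hG : 0 ≤ G)
    (h : ∀ y z, ‖a y + b z‖ ^ 2 ≤ G ^ 2 * (‖y‖ ^ 2 + ‖z‖ ^ 2)) :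
    ‖a‖ ^ 2 + ‖b‖ ^ 2 ≤ G ^ 2 := by
  have phase : ∀ w : 𝕂, ∃ c : 𝕂, ‖c‖ ≤ 1 ∧ c * w = (‖w‖ : 𝕂) := by
    intro w
    obtain ⟨c, hc, h2⟩ := RCLike.exists_norm_eq_mul_self w
    exact ⟨c, hc.le, h2.symm⟩
  have key : ∀ y z, ∀ s t : ℝ, 0 ≤ s → 0 ≤ t →
      (s * ‖a y‖ + t * ‖b z‖) ^ 2 ≤ G ^ 2 * (s ^ 2 * ‖y‖ ^ 2 + t ^ 2 * ‖z‖ ^ 2) := by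
    intro y z s t hs ht
    obtain ⟨c, hc, hcy⟩ := phase (a y)
    obtain ⟨d, hd, hdz⟩ := phase (b z)
    have h1 := h (((s : 𝕂) * c) • y) (((t : 𝕂) * d) • z)
    have e : a (((s : 𝕂) * c) • y) + b (((t : 𝕂) * d) • z)
        = ((s * ‖a y‖ + t * ‖b z‖ : ℝ) : 𝕂) := by
      rw [map_smul, map_smul, smul_eq_mul, smul_eq_mul, mul_assoc, mul_assoc, hcy, hdz]
      push_cast; rfl
    rw [e, RCLike.norm_ofReal, sq_abs] at h1
    refine h1.trans ?_
    have n1 : ‖((s : 𝕂) * c) • y‖ ≤ s * ‖y‖ := by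
      rw [norm_smul, norm_mul, RCLike.norm_ofReal, abs_of_nonneg hs]
      have : s * ‖c‖ ≤ s * 1 := by gcongr
      rw [mul_one] at this
      gcongr
    have n2 : ‖((t : 𝕂) * d) • z‖ ≤ t * ‖z‖ := by
      rw [norm_smul, norm_mul, RCLike.norm_ofReal, abs_of_nonneg ht]
      have : t * ‖d‖ ≤ t * 1 := by gcongr
      rw [mul_one] at this
      gcongr
    rw [← mul_pow, ← mul_pow]
    gcongr
  have key2 : ∀ y z, y ≠ 0 → z ≠ 0 → (‖a y‖ / ‖y‖) ^ 2 + (‖b z‖ / ‖z‖) ^ 2 ≤ G ^ 2 := by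
    intro y z hy hz
    have hy' : 0 < ‖y‖ := norm_pos_iff.2 hy
    have hz' : 0 < ‖z‖ := norm_pos_iff.2 hz
    have := key y z (‖a y‖ / ‖y‖ / ‖y‖) (‖b z‖ / ‖z‖ / ‖z‖) (by positivity) (by positivity)
    have e1 : ‖a y‖ / ‖y‖ / ‖y‖ * ‖a y‖ + ‖b z‖ / ‖z‖ / ‖z‖ * ‖b z‖
      = (‖a y‖ / ‖y‖) ^ 2 + (‖b z‖ / ‖z‖) ^ 2 := by field_simp
    have e2 : (‖a y‖ / ‖y‖ / ‖y‖) ^ 2 * ‖y‖ ^ 2 + (‖b z‖ / ‖z‖ / ‖z‖) ^ 2 * ‖z‖ ^ 2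
      = (‖a y‖ / ‖y‖) ^ 2 + (‖b z‖ / ‖z‖) ^ 2 := by field_simp
    rw [e1, e2] at this
    by_contra! hlt
    nlinarith [sq_nonneg G]
  have key1 : ∀ y, y ≠ 0 → (‖a y‖ / ‖y‖) ^ 2 ≤ G ^ 2 := by
    intro y hy
    have hy' : 0 < ‖y‖ := norm_pos_iff.2 hy
    have := key y 0 1 0 (by simp) (by simp)
    rw [div_pow, div_le_iff₀ (by positivity)]
    simpa using this
  have key3 : ∀ y, y ≠ 0 → (‖a y‖ / ‖y‖) ^ 2 + ‖b‖ ^ 2 ≤ G ^ 2 := by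
    intro y hy
    have h0 := key1 y hy
    have : ‖b‖ ≤ √(G ^ 2 - (‖a y‖ / ‖y‖) ^ 2) := by
      refine b.opNorm_le_bound (Real.sqrt_nonneg _) fun z => ?_
      by_cases hz : z = 0
      · simp [hz]
      have hz' : 0 < ‖z‖ := norm_pos_iff.2 hz
      rw [← div_le_iff₀ hz']
      apply Real.le_sqrt_of_sq_le
      linarith [key2 y z hy hz]
    have h2 := (Real.le_sqrt (norm_nonneg _) (by linarith)).1 this
    linarith
  have hb : ‖b‖ ≤ G := by
    refine b.opNorm_le_bound hG fun z => ?_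
    have := key 0 z 0 1 (by simp) (by simp)
    apply le_of_sq_le_sq_aux _ (by positivity)
    rw [mul_pow]
    simpa using this
  have hb2 : ‖b‖ ^ 2 ≤ G ^ 2 := by gcongr
  have : ‖a‖ ≤ √(G ^ 2 - ‖b‖ ^ 2) := by
    refine a.opNorm_le_bound (Real.sqrt_nonneg _) fun y => ?_
    by_cases hy : y = 0
    · simp [hy]
    have hy' : 0 < ‖y‖ := norm_pos_iff.2 hy
    rw [← div_le_iff₀ hy']
    apply Real.le_sqrt_of_sq_le
    linarith [key3 y hy]
  have h2 := (Real.le_sqrt (norm_nonneg _) (by linarith)).1 this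
  linarith

theorem aux_main {𝕂 X Y Z : Type*} [RCLike 𝕂]
    [NormedAddCommGroup X] [NormedSpace 𝕂 X]
    [NormedAddCommGroup Y] [NormedSpace 𝕂 Y]
    [NormedAddCommGroup Z] [NormedSpace 𝕂 Z]
    (R : Z →L[𝕂] X) (O : Z →L[𝕂] Y) (C : ℝ) (hC : 0 < C) (ε : ℝ) (hε : 0 < ε) :
    (∀ z : Z, ‖R z‖ ^ 2 ≤ C * ‖O z‖ ^ 2 + ε * ‖z‖ ^ 2) ↔
        (∀ xs : X →L[𝕂] 𝕂, ∃ ys : Y →L[𝕂] 𝕂,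
          1 / C * ‖ys‖ ^ 2 + 1 / ε * ‖xs.comp R - ys.comp O‖ ^ 2 ≤ ‖xs‖ ^ 2) := by
  constructor
  · intro h xs
    set c : 𝕂 := ((√C : ℝ) : 𝕂) with hc
    set e : 𝕂 := ((√ε : ℝ) : 𝕂) with he
    have hcn : ‖c‖ = √C := by rw [hc, RCLike.norm_ofReal, abs_of_nonneg (Real.sqrt_nonneg _)]
    have hen : ‖e‖ = √ε := by rw [he, RCLike.norm_ofReal, abs_of_nonneg (Real.sqrt_nonneg _)]
    have he0 : e ≠ 0 := by
      rw [← norm_pos_iff, hen]; positivity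
    let L := (WithLp.prodContinuousLinearEquiv 2 𝕂 Y Z).symm
    have hL : ∀ y z, ‖L (y, z)‖ ^ 2 = ‖y‖ ^ 2 + ‖z‖ ^ 2 := by
      intro y z
      rw [WithLp.prod_norm_sq_eq_of_L2]; rfl
    let T : Z →L[𝕂] WithLp 2 (Y × Z) :=
      (L : (Y × Z) →L[𝕂] WithLp 2 (Y × Z)).comp ((c • O).prod (e • ContinuousLinearMap.id 𝕂 Z))
    have hTz : ∀ z, T z = L (c • O z, e • z) := fun z => rfl
    have hTn : ∀ z, ‖T z‖ ^ 2 = C * ‖O z‖ ^ 2 + ε * ‖z‖ ^ 2 := by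
      intro z
      rw [hTz, hL, norm_smul, norm_smul, hcn, hen, mul_pow, mul_pow, Real.sq_sqrt hC.le,
        Real.sq_sqrt hε.le]
    have hRT : ∀ z, ‖R z‖ ≤ ‖T z‖ := by
      intro z
      apply le_of_sq_le_sq_aux _ (norm_nonneg _)
      rw [hTn]; exact h z
    have hinj : Function.Injective (T : Z →ₗ[𝕂] WithLp 2 (Y × Z)) := by
      intro z w hzw
      have h1 : L (c • O z, e • z) = L (c • O w, e • w) := hzw
      have h2 := L.injective h1
      have h3 : e • z = e • w := (Prod.mk.inj h2).2
      exact smul_right_injective Z he0 h3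
    let E := LinearEquiv.ofInjective (T : Z →ₗ[𝕂] WithLp 2 (Y × Z)) hinj
    let f0 : LinearMap.range (T : Z →ₗ[𝕂] WithLp 2 (Y × Z)) →ₗ[𝕂] 𝕂 :=
      ((xs.comp R : Z →L[𝕂] 𝕂) : Z →ₗ[𝕂] 𝕂).comp (E.symm : _ →ₗ[𝕂] Z)
    have hf0 : ∀ w, ‖f0 w‖ ≤ ‖xs‖ * ‖w‖ := by
      intro w
      obtain ⟨z, rfl⟩ := E.surjective w
      have h1 : f0 (E z) = xs (R z) := by simp [f0]
      have h2 : ‖E z‖ = ‖T z‖ := rfl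
      rw [h1, h2]
      exact (xs.le_opNorm _).trans (by gcongr; exact hRT z)
    obtain ⟨g, hg, hgn⟩ := exists_extension_norm_eq _ (f0.mkContinuous ‖xs‖ hf0)
    have hgn' : ‖g‖ ≤ ‖xs‖ := by
      rw [hgn]; exact f0.mkContinuous_norm_le (norm_nonneg _) _
    have hgT : ∀ z, g (T z) = xs (R z) := by
      intro z
      have h1 : f0 (E z) = xs (R z) := by simp [f0]
      rw [← h1]
      exact hg (E z)
    let gl : (Y × Z) →L[𝕂] 𝕂 := g.comp (L : (Y × Z) →L[𝕂] WithLp 2 (Y × Z))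
    let a := gl.comp (ContinuousLinearMap.inl 𝕂 Y Z)
    let b := gl.comp (ContinuousLinearMap.inr 𝕂 Y Z)
    have hab : ∀ y z, a y + b z = g (L (y, z)) := by
      intro y z
      change gl (y, 0) + gl (0, z) = gl (y, z)
      rw [← map_add]; simp
    have hn := aux_norm a b ‖g‖ (norm_nonneg _) (by
      intro y z
      rw [hab, ← hL, ← mul_pow]
      have := g.le_opNorm (L (y, z))
      gcongr)
    refine ⟨c • a, ?_⟩
    have hb : xs.comp R - (c • a).comp O = e • b := by
      ext z
      have h1 := hab (c • O z) (e • z)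
      rw [← hTz, hgT, map_smul, map_smul] at h1
      change xs (R z) - c • a (O z) = e • b z
      rw [← h1]; ring
    rw [hb, norm_smul, norm_smul, hcn, hen, mul_pow, mul_pow, Real.sq_sqrt hC.le,
        Real.sq_sqrt hε.le]
    have : 1 / C * (C * ‖a‖ ^ 2) + 1 / ε * (ε * ‖b‖ ^ 2) = ‖a‖ ^ 2 + ‖b‖ ^ 2 := by field_simp
    rw [this]
    exact hn.trans (by gcongr)
  · intro h z
    obtain ⟨xs, hx, hxz⟩ := exists_dual_vector'' 𝕂 (R z)
    obtain ⟨ys, hy⟩ := h xs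
    set q := xs.comp R - ys.comp O with hq
    have h1 : xs (R z) = ys (O z) + q z := by simp [hq]
    have h2 : ‖R z‖ ≤ ‖ys‖ * ‖O z‖ + ‖q‖ * ‖z‖ := by
      have : ‖R z‖ = ‖ys (O z) + q z‖ := by
        rw [← h1, hxz, RCLike.norm_ofReal, abs_of_nonneg (norm_nonneg _)]
      rw [this]
      exact (norm_add_le _ _).trans (add_le_add (ys.le_opNorm _) (q.le_opNorm _))
    have h3 : 1 / C * ‖ys‖ ^ 2 + 1 / ε * ‖q‖ ^ 2 ≤ 1 :=
      hy.trans (pow_le_one₀ (norm_nonneg _) hx)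
    have h4 : (1 / C * ‖ys‖ ^ 2 + 1 / ε * ‖q‖ ^ 2) * (C * ‖O z‖ ^ 2 + ε * ‖z‖ ^ 2)
        - (‖ys‖ * ‖O z‖ + ‖q‖ * ‖z‖) ^ 2
        = (ε * ‖ys‖ * ‖z‖ - C * ‖q‖ * ‖O z‖) ^ 2 / (C * ε) := by
      field_simp; ring
    have h5 : 0 ≤ (ε * ‖ys‖ * ‖z‖ - C * ‖q‖ * ‖O z‖) ^ 2 / (C * ε) := by positivity
    have h6 : (1 / C * ‖ys‖ ^ 2 + 1 / ε * ‖q‖ ^ 2) * (C * ‖O z‖ ^ 2 + ε * ‖z‖ ^ 2)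
        ≤ 1 * (C * ‖O z‖ ^ 2 + ε * ‖z‖ ^ 2) := by gcongr
    have h7 : ‖R z‖ ^ 2 ≤ (‖ys‖ * ‖O z‖ + ‖q‖ * ‖z‖) ^ 2 := by gcongr
    linarith

/-- Lemma 5.1: for Banach spaces `X, Y, Z` over `𝕂 = ℝ` or `ℂ` and bounded linear operators
`R : Z → X`, `O : Z → Y`, the following are equivalent, and the constant pairs can be chosen
equal: (i) `∃ Ĉ₀, ε̂₀ > 0, ∀ z, ‖Rz‖² ≤ Ĉ₀‖Oz‖² + ε̂₀‖z‖²`;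
(ii) `∃ C₀, ε₀ > 0, ∀ x* ∈ X*, ∃ y* ∈ Y*,
  (1/C₀)‖y*‖² + (1/ε₀)‖R*x* − O*y*‖² ≤ ‖x*‖²`, where `R*, O*` are the dual maps. -/
theorem observability_iff_controllability
    (𝕂 : Type*) [RCLike 𝕂] (X Y Z : Type*)
    [NormedAddCommGroup X] [NormedSpace 𝕂 X] [CompleteSpace X]
    [NormedAddCommGroup Y] [NormedSpace 𝕂 Y] [CompleteSpace Y]
    [NormedAddCommGroup Z] [NormedSpace 𝕂 Z] [CompleteSpace Z]
    (R : Z →L[𝕂] X) (O : Z →L[𝕂] Y) :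
    ((∃ C > (0 : ℝ), ∃ ε > (0 : ℝ),
        ∀ z : Z, ‖R z‖ ^ 2 ≤ C * ‖O z‖ ^ 2 + ε * ‖z‖ ^ 2) ↔
      (∃ C > (0 : ℝ), ∃ ε > (0 : ℝ),
        ∀ xs : X →L[𝕂] 𝕂, ∃ ys : Y →L[𝕂] 𝕂,
          1 / C * ‖ys‖ ^ 2 + 1 / ε * ‖xs.comp R - ys.comp O‖ ^ 2 ≤ ‖xs‖ ^ 2)) ∧
    (∀ C > (0 : ℝ), ∀ ε > (0 : ℝ),
      ((∀ z : Z, ‖R z‖ ^ 2 ≤ C * ‖O z‖ ^ 2 + ε * ‖z‖ ^ 2) ↔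
        (∀ xs : X →L[𝕂] 𝕂, ∃ ys : Y →L[𝕂] 𝕂,
          1 / C * ‖ys‖ ^ 2 + 1 / ε * ‖xs.comp R - ys.comp O‖ ^ 2 ≤ ‖xs‖ ^ 2))) := by
  refine ⟨⟨?_, ?_⟩, fun C hC ε hε => aux_main R O C hC ε hε⟩
  · rintro ⟨C, hC, ε, hε, h⟩
    exact ⟨C, hC, ε, hε, (aux_main R O C hC ε hε).1 h⟩
  · rintro ⟨C, hC, ε, hε, h⟩
    exact ⟨C, hC, ε, hε, (aux_main R O C hC ε hε).2 h⟩
end
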